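/- Let d ≥ 2 and k, n be integers with 1 ≤ k − 1 ≤ n ≤ d, and let ε > 0. There exists C > 0 such that the following holds for every odd prime power q. Let H be a graph on vertex set {1, …, k} with exactly n edges, and let c assign to each edge of H a color in 𝔽_q* = 𝔽_q \ {0}. Let E ⊆ 𝔽_q^d with |E| ≥ C·q^{d(k−1)/k}·q^{n/k}. Then the number N of k-tuples (x₁, …, x_k) of distinct points of E such that ‖x_i − x_j‖ = c({i, j}) for every edge {i, j} of H satisfies |N − |E|^k·q^{−n}| ≤ ε·|E|^k·q^{−n}. -/

import Mathlib

open Finset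
open scoped Classical

section Stepanov

open Polynomial

variable {F : Type*} [Field F]

theorem pow_sub_dvd_hasseDeriv (f s : F[X]) {e k : ℕ} (hk : k ≤ e) :
    f ^ (e - k) ∣ hasseDeriv k (f ^ e * s) := by
  induction e generalizing k with
  | zero => simp
  | succ e ih =>
    rw [pow_succ', mul_assoc, hasseDeriv_mul]
    refine Finset.dvd_sum fun ij hij => ?_
    rw [HasAntidiagonal.mem_antidiagonal] at hij
    rcases Nat.eq_zero_or_pos ij.1 with h0 | h0
    · rw [h0, hasseDeriv_zero]
      rcases hk.lt_or_eq with h | h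
      · have : e + 1 - k = (e - ij.2) + 1 := by omega
        rw [this, pow_succ']
        exact mul_dvd_mul (by simp) (ih (by omega))
      · simp [h]
    · exact Dvd.dvd.mul_left ((pow_dvd_pow f (by omega)).trans (ih (k := ij.2) (by omega))) _

theorem X_sub_C_pow_dvd_of_hasseDeriv {p : F[X]} {y : F} {l : ℕ}
    (h : ∀ k < l, (hasseDeriv k p).eval y = 0) : (X - C y) ^ l ∣ p := by
  rw [X_sub_C_pow_dvd_iff, X_pow_dvd_iff]
  intro k hk
  rw [← taylor_apply, taylor_coeff, h k hk]

theorem eq_zero_of_sq_mul_eq_C_mul_sq {f r s : F[X]} {a : F} (hf : Squarefree f)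
    (hdeg : 0 < f.natDegree) (ha : a ≠ 0) (h : r ^ 2 * f = C a * s ^ 2) : r = 0 ∧ s = 0 := by
  have hf0 : f ≠ 0 := by rintro rfl; simp at hdeg
  have hCa : (C a : F[X]) ≠ 0 := by simpa using ha
  by_cases hr : r = 0
  · subst hr
    have : s = 0 := by simpa [hCa, eq_comm (a := (0 : F[X]))] using h
    exact ⟨rfl, this⟩
  exfalso
  have hs : s ≠ 0 := by
    rintro rfl
    simp [hr, hf0] at h
  have hnu : ¬ IsUnit f := fun hu => by
    rw [natDegree_eq_zero_of_isUnit hu] at hdeg; exact lt_irrefl _ hdeg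
  obtain ⟨P, hP, hPf⟩ := WfDvdMonoid.exists_irreducible_factor hnu hf0
  have hPp := hP.prime
  have fin : ∀ {x : F[X]}, x ≠ 0 → FiniteMultiplicity P x := fun hx =>
    FiniteMultiplicity.of_not_isUnit hP.not_isUnit hx
  have h1 : multiplicity P f = 1 := by
    refine multiplicity_eq_of_dvd_of_not_dvd (by simpa using hPf) fun h2 => ?_
    rw [show 1 + 1 = 2 from rfl, pow_two] at h2
    exact hP.not_isUnit (hf _ h2)
  have h3 : multiplicity P (C a) = 0 := multiplicity_eq_zero.2 fun hd =>
    hP.not_isUnit (isUnit_of_dvd_unit hd (isUnit_C.2 ha.isUnit))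
  have h2 := congrArg (multiplicity P) h
  rw [multiplicity_mul hPp (fin (mul_ne_zero (pow_ne_zero _ hr) hf0)),
    multiplicity_mul hPp (fin (mul_ne_zero hCa (pow_ne_zero _ hs))), h1, pow_two, pow_two,
    multiplicity_mul hPp (fin (mul_ne_zero hr hr)), multiplicity_mul hPp (fin (mul_ne_zero hs hs)),
    h3] at h2
  omega

theorem X_pow_card_dvd_pow_card_sub [Fintype F] (f : F[X]) :
    X ^ Fintype.card F ∣ f ^ Fintype.card F - C (f.coeff 0) := by
  have h : expand F (Fintype.card F) f =
      expand F (Fintype.card F) f.divX * X ^ Fintype.card F + C (f.coeff 0) := by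
    conv_lhs => rw [← divX_mul_X_add f]
    rw [map_add, map_mul, expand_X, expand_C]
  rw [← FiniteField.expand_card f, h, add_sub_cancel_right]
  exact dvd_mul_left _ _

theorem eq_zero_of_X_pow_card_dvd [Fintype F] {f r s : F[X]} {D h : ℕ} (hf : Squarefree f)
    (hdeg : 0 < f.natDegree) (hf0 : f.coeff 0 ≠ 0) (hcard : 2 * h + 1 = Fintype.card F)
    (hD : 2 * D + f.natDegree ≤ Fintype.card F) (hr : r ∈ degreeLT F D) (hs : s ∈ degreeLT F D)
    (hd : X ^ Fintype.card F ∣ r + s * f ^ h) : r = 0 ∧ s = 0 := by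
  refine eq_zero_of_sq_mul_eq_C_mul_sq hf hdeg hf0 ?_
  rcases Nat.eq_zero_or_pos D with h0 | h0
  · subst h0
    rw [mem_degreeLT, Nat.cast_zero, Nat.WithBot.lt_zero_iff, degree_eq_bot] at hr hs
    simp [hr, hs]
  have h1 : X ^ Fintype.card F ∣ r ^ 2 * f - C (f.coeff 0) * s ^ 2 := by
    have e : r ^ 2 * f - C (f.coeff 0) * s ^ 2 = (r + s * f ^ h) * ((r - s * f ^ h) * f)
        + (f ^ Fintype.card F - C (f.coeff 0)) * s ^ 2 := by
      rw [← hcard]; ring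
    rw [e]
    exact dvd_add (hd.mul_right _) ((X_pow_card_dvd_pow_card_sub f).mul_right _)
  have nd : ∀ {p : F[X]}, p ∈ degreeLT F D → p.natDegree ≤ D - 1 := fun {p} hp => by
    rw [mem_degreeLT] at hp
    by_cases hp0 : p = 0
    · simp [hp0]
    · have := (natDegree_lt_iff_degree_lt hp0).2 hp
      omega
  have h2 : (r ^ 2 * f - C (f.coeff 0) * s ^ 2).natDegree < Fintype.card F := by
    refine (natDegree_sub_le _ _).trans_lt (max_lt ?_ ?_)
    · refine (natDegree_mul_le.trans (Nat.add_le_add_right natDegree_pow_le _)).trans_lt ?_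
      have := nd hr
      omega
    · refine (natDegree_C_mul_le _ _).trans_lt (natDegree_pow_le.trans_lt ?_)
      have := nd hs
      omega
  exact sub_eq_zero.1 (eq_zero_of_dvd_of_natDegree_lt h1 (by simpa using h2))

theorem eq_zero_of_sum_mul_X_pow_card [Fintype F] {f : F[X]} {D h : ℕ} (hf : Squarefree f)
    (hdeg : 0 < f.natDegree) (hf0 : f.coeff 0 ≠ 0) (hcard : 2 * h + 1 = Fintype.card F)
    (hD : 2 * D + f.natDegree ≤ Fintype.card F) {J : ℕ} {r s : Fin J → F[X]}
    (hr : ∀ j, r j ∈ degreeLT F D) (hs : ∀ j, s j ∈ degreeLT F D)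
    (hsum : ∑ j, (r j + s j * f ^ h) * (X ^ Fintype.card F) ^ (j : ℕ) = 0) :
    ∀ j, r j = 0 ∧ s j = 0 := by
  induction J with
  | zero => exact fun j => j.elim0
  | succ J ih =>
    rw [Fin.sum_univ_succ] at hsum
    have e : ∑ j : Fin J, (r j.succ + s j.succ * f ^ h) * (X ^ Fintype.card F) ^ (j.succ : ℕ)
        = X ^ Fintype.card F *
          ∑ j : Fin J, (r j.succ + s j.succ * f ^ h) * (X ^ Fintype.card F) ^ (j : ℕ) := by
      rw [mul_sum]
      refine sum_congr rfl fun j _ => ?_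
      rw [Fin.val_succ, pow_succ]; ring
    rw [e] at hsum
    have h0 : r 0 = 0 ∧ s 0 = 0 := by
      refine eq_zero_of_X_pow_card_dvd hf hdeg hf0 hcard hD (hr 0) (hs 0) ?_
      have := eq_neg_of_add_eq_zero_left hsum
      simp only [Fin.val_zero, pow_zero, mul_one] at this
      rw [this]
      exact (dvd_mul_right _ _).neg_right
    rw [h0.1, h0.2] at hsum
    simp only [zero_mul, add_zero, zero_add, mul_eq_zero, pow_eq_zero_iff', X_ne_zero, false_and,
      false_or] at hsum
    exact Fin.cases h0 (ih (fun j => hr _) (fun j => hs _) hsum)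

/-- The condition imposed on the coefficients of the auxiliary polynomial by the `k`-th
Hasse derivative, at points where `f ^ h = a`. -/
noncomputable def stepanovCondition (f : F[X]) (a : F) (l J D h k : ℕ) :
    ((Fin J → degreeLT F D) × (Fin J → degreeLT F D)) →ₗ[F] F[X] :=
  ∑ j : Fin J, (LinearMap.mulLeft F (X ^ (j : ℕ) * f ^ h) ∘ₗ hasseDeriv k ∘ₗ
      LinearMap.mulLeft F (f ^ l) ∘ₗ (degreeLT F D).subtype ∘ₗ LinearMap.proj j ∘ₗ
      LinearMap.fst F _ _ +
    LinearMap.mulLeft F (X ^ (j : ℕ) * C a) ∘ₗ hasseDeriv k ∘ₗ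
      LinearMap.mulLeft F (f ^ (l + h)) ∘ₗ (degreeLT F D).subtype ∘ₗ LinearMap.proj j ∘ₗ
      LinearMap.snd F _ _)

theorem stepanovCondition_apply (f : F[X]) (a : F) (l J D h k : ℕ)
    (v : (Fin J → degreeLT F D) × (Fin J → degreeLT F D)) :
    stepanovCondition f a l J D h k v = ∑ j : Fin J,
      (X ^ (j : ℕ) * f ^ h * hasseDeriv k (f ^ l * (v.1 j : F[X])) +
        X ^ (j : ℕ) * C a * hasseDeriv k (f ^ (l + h) * (v.2 j : F[X]))) := by
  simp [stepanovCondition, LinearMap.sum_apply, mul_assoc]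

theorem exists_hasseDeriv_eq (f : F[X]) (s : F[X]) {e k D : ℕ} (hs : s ∈ degreeLT F D)
    (hk : k ≤ e) (hf : f ≠ 0) :
    ∃ t ∈ degreeLT F (k * f.natDegree + D), hasseDeriv k (f ^ e * s) = f ^ (e - k) * t := by
  obtain ⟨t, ht⟩ := pow_sub_dvd_hasseDeriv f s hk
  refine ⟨t, ?_, ht⟩
  rw [mem_degreeLT] at hs ⊢
  by_cases ht0 : t = 0
  · rw [ht0, degree_zero]; exact WithBot.bot_lt_coe _
  have hs0 : s ≠ 0 := by
    rintro rfl
    simp [hf, ht0] at ht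
  have h1 := natDegree_hasseDeriv_le (f ^ e * s) k
  rw [ht, natDegree_mul (pow_ne_zero _ hf) ht0, natDegree_mul (pow_ne_zero _ hf) hs0,
    natDegree_pow, natDegree_pow] at h1
  rw [← natDegree_lt_iff_degree_lt hs0] at hs
  rw [← natDegree_lt_iff_degree_lt ht0]
  obtain ⟨i, rfl⟩ := Nat.exists_eq_add_of_le hk
  rw [Nat.add_sub_cancel_left, add_mul] at h1
  omega

theorem stepanovCondition_mem (f : F[X]) (hf : f ≠ 0) (a : F) {l J D h k : ℕ} (hk : k ≤ l)
    (v : (Fin J → degreeLT F D) × (Fin J → degreeLT F D)) :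
    stepanovCondition f a l J D h k v ∈ (degreeLT F (k * f.natDegree + D + J)).map
      (LinearMap.mulLeft F (f ^ (l + h - k))) := by
  rw [stepanovCondition_apply]
  refine Submodule.sum_mem _ fun j _ => ?_
  have key : ∀ {t : F[X]} (b : F), t ∈ degreeLT F (k * f.natDegree + D) →
      X ^ (j : ℕ) * C b * t ∈ degreeLT F (k * f.natDegree + D + J) := fun {t} b ht => by
    by_cases ht0 : X ^ (j : ℕ) * C b * t = 0
    · rw [ht0]; exact Submodule.zero_mem _
    have ht1 : t ≠ 0 := right_ne_zero_of_mul ht0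
    rw [mem_degreeLT, ← natDegree_lt_iff_degree_lt] at ht ⊢
    · refine natDegree_mul_le.trans_lt ?_
      have : (X ^ (j : ℕ) * C b : F[X]).natDegree ≤ j :=
        (natDegree_mul_C_le _ _).trans (natDegree_X_pow_le _)
      have := j.2
      omega
    · exact ht0
    · exact ht1
  refine Submodule.add_mem _ ?_ ?_
  · obtain ⟨t, ht, e⟩ := exists_hasseDeriv_eq f _ (v.1 j).2 hk hf
    refine ⟨X ^ (j : ℕ) * C 1 * t, key 1 ht, ?_⟩
    rw [LinearMap.mulLeft_apply, e, show l + h - k = (l - k) + h by omega, pow_add, C_1]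
    ring
  · obtain ⟨t, ht, e⟩ := exists_hasseDeriv_eq f _ (v.2 j).2 (hk.trans (Nat.le_add_right l h)) hf
    refine ⟨X ^ (j : ℕ) * C a * t, key a ht, ?_⟩
    rw [LinearMap.mulLeft_apply, e]
    ring

theorem exists_stepanovCondition_eq_zero (f : F[X]) (hf : f ≠ 0) (a : F) {l J D h : ℕ}
    (hdim : l * (l * f.natDegree + D + J) < 2 * (J * D)) :
    ∃ v : (Fin J → degreeLT F D) × (Fin J → degreeLT F D), v ≠ 0 ∧
      ∀ k < l, stepanovCondition f a l J D h k v = 0 := by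
  have fr : ∀ n, Module.finrank F (degreeLT F n) = n := fun n => by
    rw [(degreeLTEquiv F n).finrank_eq, Module.finrank_fin_fun]
  have fd : ∀ n, FiniteDimensional F (degreeLT F n) := fun n =>
    Module.Finite.equiv (degreeLTEquiv F n).symm
  let W : Fin l → Submodule F F[X] := fun k =>
    (degreeLT F ((k : ℕ) * f.natDegree + D + J)).map (LinearMap.mulLeft F (f ^ (l + h - k)))
  let Φ : ((Fin J → degreeLT F D) × (Fin J → degreeLT F D)) →ₗ[F] ((k : Fin l) → W k) :=
    LinearMap.pi fun k => (stepanovCondition f a l J D h k).codRestrict (W k)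
      fun v => stepanovCondition_mem f hf a k.2.le v
  have hlt : Module.finrank F ((k : Fin l) → W k) <
      Module.finrank F ((Fin J → degreeLT F D) × (Fin J → degreeLT F D)) := by
    rw [Module.finrank_pi_fintype, Module.finrank_prod, Module.finrank_pi_fintype]
    simp only [fr, sum_const, card_univ, Fintype.card_fin, smul_eq_mul]
    have : ∑ k : Fin l, Module.finrank F (W k) ≤ ∑ k : Fin l, (l * f.natDegree + D + J) := by
      refine sum_le_sum fun k _ => (Submodule.finrank_map_le _ _).trans ?_
      rw [fr]
      gcongr
      exact k.2.le
    rw [sum_const, card_univ, Fintype.card_fin, smul_eq_mul] at this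
    omega
  obtain ⟨v, hv, hv0⟩ := Submodule.exists_mem_ne_zero_of_ne_bot
    (LinearMap.ker_ne_bot_of_finrank_lt hlt)
  refine ⟨v, hv0, fun k hk => ?_⟩
  have h0 : Φ v = 0 := LinearMap.mem_ker.1 hv
  exact congrArg Subtype.val (congrFun h0 ⟨k, hk⟩)

/-- **Stepanov's method** for the values of `f ^ ((|F| - 1) / 2)`. -/
theorem stepanov_bound [Fintype F] {f : F[X]} (hf : Squarefree f) (hdeg : 0 < f.natDegree)
    (hf0 : f.coeff 0 ≠ 0) {a : F} (ha : a ≠ 0) {l J D h : ℕ}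
    (hcard : 2 * h + 1 = Fintype.card F) (hl : l ≤ Fintype.card F)
    (hD : 2 * D + f.natDegree ≤ Fintype.card F)
    (hdim : l * (l * f.natDegree + D + J) < 2 * (J * D)) :
    l * #{y : F | f.eval y ^ h = a} ≤
      l * f.natDegree + D + h * f.natDegree + J * Fintype.card F := by
  have hf' : f ≠ 0 := by rintro rfl; simp at hdeg
  obtain ⟨v, hv0, hv⟩ := exists_stepanovCondition_eq_zero (h := h) f hf' a hdim
  set q := Fintype.card F
  set R : F[X] := f ^ l * ∑ j : Fin J, ((v.1 j : F[X]) + (v.2 j : F[X]) * f ^ h) * (X ^ q) ^ (j : ℕ)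
    with hR
  have hR0 : R ≠ 0 := by
    refine mul_ne_zero (pow_ne_zero _ hf') fun h0 => hv0 ?_
    have := eq_zero_of_sum_mul_X_pow_card hf hdeg hf0 hcard hD (fun j => (v.1 j).2)
      (fun j => (v.2 j).2) h0
    exact Prod.ext (funext fun j => Subtype.ext (this j).1) (funext fun j => Subtype.ext (this j).2)
  have hdvd : ∀ y, f.eval y ^ h = a → (X - C y) ^ l ∣ R := by
    intro y hy
    set U : F[X] := f ^ l * ∑ j : Fin J, ((v.1 j : F[X]) + (v.2 j : F[X]) * f ^ h) * C (y ^ (j : ℕ))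
    have h1 : (X - C y) ^ l ∣ R - U := by
      rw [hR, ← mul_sub, ← sum_sub_distrib]
      refine Dvd.dvd.mul_left (Finset.dvd_sum fun j _ => ?_) _
      rw [← mul_sub]
      refine Dvd.dvd.mul_left ((pow_dvd_pow _ hl).trans ?_) _
      have e : (X - C y) ^ q = X ^ q - C y := by
        have := FiniteField.expand_card (X - C y)
        rw [map_sub, expand_X, expand_C] at this
        exact this.symm
      rw [e, C_pow]
      exact sub_dvd_pow_sub_pow _ _ _
    have h2 : (X - C y) ^ l ∣ U := by
      refine X_sub_C_pow_dvd_of_hasseDeriv fun k hk => ?_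
      have h3 := congrArg (eval y) (hv k hk)
      rw [stepanovCondition_apply, eval_zero, eval_finsetSum] at h3
      refine (mul_eq_zero.1 (Eq.trans ?_ h3)).resolve_left ha
      simp only [U, mul_sum]
      rw [map_sum, eval_finsetSum, mul_sum]
      refine sum_congr rfl fun j _ => ?_
      have e : f ^ l * (((v.1 j : F[X]) + (v.2 j : F[X]) * f ^ h) * C (y ^ (j : ℕ))) =
          y ^ (j : ℕ) • (f ^ l * (v.1 j : F[X]) + f ^ (l + h) * (v.2 j : F[X])) := by
        rw [smul_eq_C_mul, pow_add]; ring
      rw [e, map_smul, map_add]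
      simp only [eval_smul, eval_add, eval_mul, eval_pow, eval_X, eval_C, hy, smul_eq_mul]
      ring
    simpa using dvd_add h1 h2
  have hprod : ∏ y ∈ ({y : F | f.eval y ^ h = a} : Finset F), (X - C y) ^ l ∣ R := by
    refine Finset.prod_dvd_of_coprime (fun y _ z _ hyz => ?_) fun y hy => hdvd y (by simpa using hy)
    exact (isCoprime_X_sub_C_of_isUnit_sub (sub_ne_zero.2 hyz).isUnit).pow
  have hle := natDegree_le_of_dvd hprod hR0
  rw [natDegree_prod _ _ fun y _ => pow_ne_zero _ (X_sub_C_ne_zero y)] at hle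
  simp only [natDegree_pow, natDegree_X_sub_C, mul_one, sum_const, smul_eq_mul] at hle
  rw [mul_comm]
  refine hle.trans (natDegree_mul_le.trans ?_)
  rw [natDegree_pow, add_assoc, add_assoc]
  refine Nat.add_le_add_left (natDegree_sum_le_of_forall_le _ _ fun j _ => ?_) _
  have nd : ∀ p : degreeLT F D, (p : F[X]).natDegree ≤ D := fun p => by
    refine natDegree_le_of_degree_le ?_
    exact (mem_degreeLT.1 p.2).le
  refine natDegree_mul_le.trans ?_
  have h1 : (((v.1 j : F[X]) + (v.2 j : F[X]) * f ^ h)).natDegree ≤ D + h * f.natDegree := by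
    refine (natDegree_add_le _ _).trans (max_le ((nd _).trans (Nat.le_add_right _ _)) ?_)
    exact natDegree_mul_le.trans (add_le_add (nd _) natDegree_pow_le)
  have h2 : (((X : F[X]) ^ q) ^ (j : ℕ)).natDegree ≤ J * q := by
    rw [← pow_mul, natDegree_X_pow, mul_comm]
    exact Nat.mul_le_mul_right _ j.2.le
  omega

end Stepanov

section MonicPolynomials

open Polynomial

variable (K : Type*) [Field K] [Fintype K]

/-- The monic polynomials of degree `m` over a finite field. -/
noncomputable def monicsOfDegree (m : ℕ) : Finset K[X] :=
  univ.image fun v : Fin m → K => X ^ m + ∑ i, C (v i) * X ^ (i : ℕ)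

variable {K}

theorem coeff_X_pow_add_sum {K : Type*} [Field K] {m : ℕ} (v : Fin m → K) (i : Fin m) :
    (X ^ m + ∑ j, C (v j) * X ^ (j : ℕ) : K[X]).coeff i = v i := by
  simp [coeff_X_pow, i.2.ne, Fin.val_inj, finsetSum_coeff]

theorem degree_sum_C_mul_X_pow_lt {K : Type*} [Field K] {m : ℕ} (v : Fin m → K) :
    (∑ j, C (v j) * X ^ (j : ℕ) : K[X]).degree < m := by
  rw [← mem_degreeLT]
  refine Submodule.sum_mem _ fun j _ => ?_
  rw [mem_degreeLT]
  exact (degree_C_mul_X_pow_le _ _).trans_lt (by exact_mod_cast j.2)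

theorem mem_monicsOfDegree {m : ℕ} {f : K[X]} :
    f ∈ monicsOfDegree K m ↔ f.Monic ∧ f.natDegree = m := by
  simp only [monicsOfDegree, mem_image, mem_univ, true_and]
  constructor
  · rintro ⟨v, rfl⟩
    have h := degree_sum_C_mul_X_pow_lt v
    refine ⟨monic_X_pow_add h, ?_⟩
    rw [natDegree_add_eq_left_of_degree_lt (by simpa using h), natDegree_X_pow]
  · rintro ⟨hf, rfl⟩
    refine ⟨fun i => f.coeff i, ?_⟩
    conv_rhs => rw [hf.as_sum]
    rw [Fin.sum_univ_eq_sum_range fun i => C (f.coeff i) * X ^ i]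

theorem sum_monicsOfDegree (m : ℕ) (g : K[X] → ℂ) :
    ∑ f ∈ monicsOfDegree K m, g f =
      ∑ v : Fin m → K, g (X ^ m + ∑ i, C (v i) * X ^ (i : ℕ)) := by
  refine sum_image fun v _ w _ h => funext fun i => ?_
  rw [← coeff_X_pow_add_sum v i, ← coeff_X_pow_add_sum w i]
  exact congrArg (fun p : K[X] => p.coeff i) h

variable (K) in
/-- The monic irreducible polynomials of degree at most `N`. -/
noncomputable def monicIrreducibles (N : ℕ) : Finset K[X] :=
  ((range (N + 1)).biUnion (monicsOfDegree K)).filter Irreducible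

theorem mem_monicIrreducibles {N : ℕ} {P : K[X]} :
    P ∈ monicIrreducibles K N ↔ P.Monic ∧ P.natDegree ≤ N ∧ Irreducible P := by
  simp only [monicIrreducibles, mem_filter, mem_biUnion, mem_range, mem_monicsOfDegree]
  constructor
  · rintro ⟨⟨d, hd, hm, rfl⟩, hi⟩
    exact ⟨hm, by omega, hi⟩
  · rintro ⟨hm, hd, hi⟩
    exact ⟨⟨_, by omega, hm, rfl⟩, hi⟩

/-- The degree of a polynomial as a sum over its prime power divisors. -/
theorem sum_natDegree_prime_pow_dvd {m : ℕ} {f : K[X]} (hf : f ∈ monicsOfDegree K m) :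
    ∑ P ∈ monicIrreducibles K m, ∑ _j ∈ (Icc 1 m).filter (fun j => P ^ j ∣ f), P.natDegree
      = m := by
  obtain ⟨hm, hd⟩ := mem_monicsOfDegree.1 hf
  have hf0 := hm.ne_zero
  set N := UniqueFactorizationMonoid.normalizedFactors f
  have hNm : ∀ P ∈ N, P.Monic := fun P hP => by
    have h1 := UniqueFactorizationMonoid.normalize_normalized_factor P hP
    rw [← h1]
    exact monic_normalize (UniqueFactorizationMonoid.irreducible_of_normalized_factor P hP).ne_zero
  have hprod : N.prod = f := by
    have h1 : Associated N.prod f := UniqueFactorizationMonoid.prod_normalizedFactors hf0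
    have h2 : N.prod.Monic := by
      simpa using monic_multiset_prod_of_monic N id hNm
    exact eq_of_monic_of_associated h2 hm h1
  have hsub : N.toFinset ⊆ monicIrreducibles K m := fun P hP => by
    rw [Multiset.mem_toFinset] at hP
    refine mem_monicIrreducibles.2 ⟨hNm P hP, ?_,
      UniqueFactorizationMonoid.irreducible_of_normalized_factor P hP⟩
    rw [← hd]
    exact natDegree_le_of_dvd (UniqueFactorizationMonoid.dvd_of_mem_normalizedFactors hP) hf0
  have hcount : ∀ P ∈ monicIrreducibles K m,
      ((Icc 1 m).filter fun j => P ^ j ∣ f).card = N.count P := fun P hP => by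
    obtain ⟨hPm, hPd, hPi⟩ := mem_monicIrreducibles.1 hP
    have key : ∀ j, P ^ j ∣ f ↔ j ≤ N.count P := fun j => by
      rw [pow_dvd_iff_le_emultiplicity,
        UniqueFactorizationMonoid.emultiplicity_eq_count_normalizedFactors hPi hf0,
        hPm.normalize_eq_self, Nat.cast_le]
    have hle : N.count P ≤ m := by
      have h1 := natDegree_le_of_dvd ((key _).2 le_rfl) hf0
      rw [natDegree_pow, hd] at h1
      exact (Nat.le_mul_of_pos_right _ hPi.natDegree_pos).trans h1
    have : ((Icc 1 m).filter fun j => P ^ j ∣ f) = Icc 1 (N.count P) := by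
      ext j
      simp only [mem_filter, mem_Icc, key]
      omega
    rw [this, Nat.card_Icc, Nat.add_sub_cancel]
  have h2 : f.natDegree = ∑ P ∈ N.toFinset, N.count P * P.natDegree := by
    conv_lhs => rw [← hprod]
    rw [natDegree_multiset_prod_of_monic _ hNm, Finset.sum_multiset_map_count]
    simp
  calc _ = ∑ P ∈ monicIrreducibles K m, N.count P * P.natDegree := by
        refine sum_congr rfl fun P hP => ?_
        rw [sum_const, smul_eq_mul, hcount P hP]
    _ = ∑ P ∈ N.toFinset, N.count P * P.natDegree := by
        refine (sum_subset hsub fun P _ hP => ?_).symm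
        rw [Multiset.mem_toFinset] at hP
        simp [Multiset.count_eq_zero.2 hP]
    _ = m := by rw [← h2, hd]

end MonicPolynomials

section KloostermanLFunction

open Polynomial

variable {K : Type*} [Field K]

/-- The completely multiplicative weight on monic polynomials attached to the Kloosterman sum:
for `f` with roots `xᵢ ≠ 0` it is `ψ (∑ (a xᵢ + b / xᵢ))`. -/
noncomputable def kloostermanWeight (ψ : AddChar K ℂ) (a b : K) (f : K[X]) : ℂ :=
  if f.coeff 0 = 0 then 0 else ψ (-(a * f.nextCoeff + b * (f.coeff 1 / f.coeff 0)))

theorem kloostermanWeight_one (ψ : AddChar K ℂ) (a b : K) : kloostermanWeight ψ a b 1 = 1 := by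
  simp [kloostermanWeight, coeff_one, nextCoeff]

theorem kloostermanWeight_mul (ψ : AddChar K ℂ) (a b : K) {f g : K[X]} (hf : f.Monic)
    (hg : g.Monic) :
    kloostermanWeight ψ a b (f * g) = kloostermanWeight ψ a b f * kloostermanWeight ψ a b g := by
  unfold kloostermanWeight
  rw [mul_coeff_zero]
  by_cases h1 : f.coeff 0 = 0
  · simp [h1]
  by_cases h2 : g.coeff 0 = 0
  · simp [h2]
  rw [if_neg (mul_ne_zero h1 h2), if_neg h1, if_neg h2, ← AddChar.map_add_eq_mul,
    hf.nextCoeff_mul hg, mul_coeff_one]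
  congr 1
  field_simp
  ring

theorem kloostermanWeight_pow (ψ : AddChar K ℂ) (a b : K) {f : K[X]} (hf : f.Monic) (j : ℕ) :
    kloostermanWeight ψ a b (f ^ j) = kloostermanWeight ψ a b f ^ j := by
  induction j with
  | zero => simp [kloostermanWeight_one]
  | succ j ih => rw [pow_succ, kloostermanWeight_mul ψ a b (hf.pow j) hf, ih, pow_succ]

variable [Fintype K]

/-- The coefficients of the L-function of the Kloosterman sum. -/
noncomputable def kloostermanLCoeff (ψ : AddChar K ℂ) (a b : K) (m : ℕ) : ℂ :=
  ∑ f ∈ monicsOfDegree K m, kloostermanWeight ψ a b f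

/-- The Kloosterman sum over the extension of degree `n`, as a sum over monic irreducibles. -/
noncomputable def kloostermanIrreducibleSum (ψ : AddChar K ℂ) (a b : K) (n : ℕ) : ℂ :=
  ∑ P ∈ (monicIrreducibles K n).filter (fun P => P.natDegree ∣ n),
    P.natDegree * kloostermanWeight ψ a b P ^ (n / P.natDegree)

theorem sum_kloostermanWeight_pow_dvd (ψ : AddChar K ℂ) (a b : K) {P : K[X]} (hP : P.Monic)
    (m j : ℕ) :
    ∑ f ∈ (monicsOfDegree K m).filter (fun f => P ^ j ∣ f), kloostermanWeight ψ a b f =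
      if j * P.natDegree ≤ m then
        kloostermanWeight ψ a b P ^ j * kloostermanLCoeff ψ a b (m - j * P.natDegree) else 0 := by
  split_ifs with h
  · rw [kloostermanLCoeff, mul_sum]
    symm
    refine sum_bij (fun g _ => P ^ j * g) ?_ ?_ ?_ ?_
    · intro g hg
      obtain ⟨hg1, hg2⟩ := mem_monicsOfDegree.1 hg
      refine mem_filter.2 ⟨mem_monicsOfDegree.2 ⟨(hP.pow j).mul hg1, ?_⟩, dvd_mul_right _ _⟩
      rw [(hP.pow j).natDegree_mul hg1, hP.natDegree_pow, hg2]
      omega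
    · intro g _ g' _ hgg
      exact mul_left_cancel₀ (hP.pow j).ne_zero hgg
    · intro f hf
      obtain ⟨hf, g, rfl⟩ := mem_filter.1 hf
      obtain ⟨hf1, hf2⟩ := mem_monicsOfDegree.1 hf
      have hg := (hP.pow j).of_mul_monic_left hf1
      refine ⟨g, mem_monicsOfDegree.2 ⟨hg, ?_⟩, rfl⟩
      rw [(hP.pow j).natDegree_mul hg, hP.natDegree_pow] at hf2
      omega
    · intro g hg
      rw [kloostermanWeight_mul ψ a b (hP.pow j) (mem_monicsOfDegree.1 hg).1,
        kloostermanWeight_pow ψ a b hP]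
  · rw [filter_eq_empty_iff.2, sum_empty]
    rintro f hf ⟨g, rfl⟩
    obtain ⟨hf1, hf2⟩ := mem_monicsOfDegree.1 hf
    rw [(hP.pow j).natDegree_mul ((hP.pow j).of_mul_monic_left hf1), hP.natDegree_pow] at hf2
    omega

/-- Newton's identity: the logarithmic derivative of the L-function. -/
theorem natCast_mul_kloostermanLCoeff (ψ : AddChar K ℂ) (a b : K) (m : ℕ) :
    (m : ℂ) * kloostermanLCoeff ψ a b m =
      ∑ n ∈ Icc 1 m, kloostermanIrreducibleSum ψ a b n * kloostermanLCoeff ψ a b (m - n) := by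
  have h1 : (m : ℂ) * kloostermanLCoeff ψ a b m = ∑ P ∈ monicIrreducibles K m, ∑ j ∈ Icc 1 m,
      (P.natDegree : ℂ) *
        ∑ f ∈ (monicsOfDegree K m).filter (fun f => P ^ j ∣ f), kloostermanWeight ψ a b f := by
    calc (m : ℂ) * kloostermanLCoeff ψ a b m
        = ∑ f ∈ monicsOfDegree K m, ∑ P ∈ monicIrreducibles K m, ∑ j ∈ Icc 1 m,
            if P ^ j ∣ f then (P.natDegree : ℂ) * kloostermanWeight ψ a b f else 0 := by
          rw [kloostermanLCoeff, mul_sum]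
          refine sum_congr rfl fun f hf => ?_
          have h := congrArg (Nat.cast (R := ℂ)) (sum_natDegree_prime_pow_dvd hf)
          rw [← h]
          push_cast
          simp_rw [← sum_filter, sum_mul]
      _ = _ := by
          rw [sum_comm]
          refine sum_congr rfl fun P _ => ?_
          rw [sum_comm]
          refine sum_congr rfl fun j _ => ?_
          rw [mul_sum, ← sum_filter]
  rw [h1]
  have h2 : ∀ n ∈ Icc 1 m, kloostermanIrreducibleSum ψ a b n * kloostermanLCoeff ψ a b (m - n) =
      ∑ P ∈ monicIrreducibles K m, if P.natDegree ∣ n then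
        P.natDegree * (kloostermanWeight ψ a b P ^ (n / P.natDegree) *
          kloostermanLCoeff ψ a b (m - n)) else 0 := by
    intro n hn
    rw [mem_Icc] at hn
    rw [kloostermanIrreducibleSum, sum_mul, ← sum_filter]
    refine sum_congr ?_ fun P _ => by ring
    ext P
    simp only [mem_filter, mem_monicIrreducibles]
    constructor
    · rintro ⟨⟨h1, h2, h3⟩, h4⟩
      exact ⟨⟨h1, h2.trans hn.2, h3⟩, h4⟩
    · rintro ⟨⟨h1, h2, h3⟩, h4⟩
      exact ⟨⟨h1, Nat.le_of_dvd hn.1 h4, h3⟩, h4⟩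
  rw [sum_congr rfl h2, sum_comm (s := Icc 1 m)]
  refine sum_congr rfl fun P hP => ?_
  obtain ⟨hPm, -, hPi⟩ := mem_monicIrreducibles.1 hP
  have hd := hPi.natDegree_pos
  simp_rw [sum_kloostermanWeight_pow_dvd ψ a b hPm, mul_ite, mul_zero]
  rw [← sum_filter, ← sum_filter]
  refine sum_nbij' (fun j => j * P.natDegree) (fun n => n / P.natDegree) ?_ ?_ ?_ ?_ ?_
  · intro j hj
    simp only [mem_filter, mem_Icc] at hj ⊢
    exact ⟨⟨Nat.mul_pos hj.1.1 hd, hj.2⟩, dvd_mul_left _ _⟩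
  · intro n hn
    simp only [mem_filter, mem_Icc] at hn ⊢
    obtain ⟨⟨hn1, hn2⟩, hn3⟩ := hn
    refine ⟨⟨Nat.div_pos (Nat.le_of_dvd hn1 hn3) hd, (Nat.div_le_self _ _).trans hn2⟩, ?_⟩
    rwa [Nat.div_mul_cancel hn3]
  · intro j _
    exact Nat.mul_div_cancel _ hd
  · intro n hn
    exact Nat.div_mul_cancel (mem_filter.1 hn).2
  · intro j _
    rw [Nat.mul_div_cancel _ hd]

theorem kloostermanLCoeff_zero (ψ : AddChar K ℂ) (a b : K) : kloostermanLCoeff ψ a b 0 = 1 := by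
  rw [kloostermanLCoeff, sum_monicsOfDegree]
  simp [kloostermanWeight_one]

theorem kloostermanWeight_X_pow_add_sum (ψ : AddChar K ℂ) (a b : K) {m : ℕ}
    (v : Fin (m + 2) → K) :
    kloostermanWeight ψ a b (X ^ (m + 2) + ∑ i, C (v i) * X ^ (i : ℕ)) =
      if v 0 = 0 then 0 else ψ (-(a * v (Fin.last _) + b * (v 1 / v 0))) := by
  have hn : (X ^ (m + 2) + ∑ i, C (v i) * X ^ (i : ℕ) : K[X]).natDegree = m + 2 :=
    (mem_monicsOfDegree.1 (mem_image_of_mem _ (mem_univ v))).2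
  have h0 := coeff_X_pow_add_sum v 0
  have h1 := coeff_X_pow_add_sum v 1
  have h2 := coeff_X_pow_add_sum v (Fin.last _)
  rw [kloostermanWeight, nextCoeff_of_natDegree_pos (by omega), hn]
  simp only [Fin.val_zero, Fin.val_one, Fin.val_last] at h0 h1 h2
  rw [h0, h1, show m + 2 - 1 = m + 1 from rfl, h2]

theorem sum_addChar_mul {ψ : AddChar K ℂ} (hψ : ψ ≠ 1) (c : K) :
    ∑ x, ψ (c * x) = if c = 0 then (Fintype.card K : ℂ) else 0 := by
  split_ifs with h
  · simp [h]
  · have := AddChar.sum_eq_zero_of_ne_one ((AddChar.IsPrimitive.of_ne_one hψ) h)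
    simpa [AddChar.mulShift_apply] using this

theorem kloostermanLCoeff_one (ψ : AddChar K ℂ) (a b : K) :
    kloostermanLCoeff ψ a b 1 = ∑ x, if x = 0 then 0 else ψ (a * x + b * x⁻¹) := by
  rw [kloostermanLCoeff, sum_monicsOfDegree]
  refine Fintype.sum_equiv ((Equiv.funUnique (Fin 1) K).trans (Equiv.neg K)) _ _ fun v => ?_
  have hn : (X ^ 1 + ∑ i : Fin 1, C (v i) * X ^ (i : ℕ) : K[X]) = X + C (v 0) := by simp
  have e : ((Equiv.funUnique (Fin 1) K).trans (Equiv.neg K)) v = -v 0 := rfl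
  rw [hn, e, kloostermanWeight, nextCoeff_X_add_C]
  by_cases h : v 0 = 0
  · simp [h]
  · simp only [coeff_add, coeff_X_zero, coeff_C_zero, zero_add, h, if_false, neg_eq_zero,
      coeff_X_one, coeff_C_succ, add_zero]
    congr 1
    rw [one_div, inv_neg]
    ring

theorem kloostermanLCoeff_two {ψ : AddChar K ℂ} (hψ : ψ ≠ 1) {a b : K} (ha : a ≠ 0)
    (hb : b ≠ 0) : kloostermanLCoeff ψ a b 2 = Fintype.card K := by
  rw [kloostermanLCoeff, sum_monicsOfDegree, ← (finTwoArrowEquiv K).symm.sum_comp,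
    Fintype.sum_prod_type]
  have h : ∀ v u : K, kloostermanWeight ψ a b
      (X ^ 2 + ∑ i, C ((finTwoArrowEquiv K).symm (v, u) i) * X ^ (i : ℕ)) =
      if v = 0 then 0 else ψ (-(a + b / v) * u) := fun v u => by
    rw [kloostermanWeight_X_pow_add_sum (m := 0)]
    simp only [finTwoArrowEquiv_symm_apply, Matrix.cons_val_zero, Matrix.cons_val_one, Fin.last]
    split_ifs with hv
    · rfl
    · congr 1
      simp
      ring
  simp_rw [h]
  have h2 : ∀ v : K, (∑ u, if v = 0 then (0 : ℂ) else ψ (-(a + b / v) * u)) =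
      if v = -b / a then (Fintype.card K : ℂ) else 0 := fun v => by
    by_cases hv : v = 0
    · have : ¬ (0 = -b / a) := by simp [ha, hb, eq_comm]
      simp [hv, this]
    · simp only [hv, if_false]
      rw [sum_addChar_mul hψ]
      congr 1
      rw [eq_iff_iff, neg_eq_zero, eq_div_iff ha]
      field_simp
      constructor <;> intro h <;> linear_combination h
  rw [sum_congr rfl fun v _ => h2 v]
  simp

theorem kloostermanLCoeff_eq_zero {ψ : AddChar K ℂ} (hψ : ψ ≠ 1) {a b : K} (ha : a ≠ 0)
    {m : ℕ} (hm : 3 ≤ m) : kloostermanLCoeff ψ a b m = 0 := by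
  obtain ⟨m, rfl⟩ := Nat.exists_eq_add_of_le' hm
  rw [kloostermanLCoeff, sum_monicsOfDegree,
    ← (Fin.snocEquiv fun _ : Fin (m + 3) => K).sum_comp, Fintype.sum_prod_type_right]
  refine sum_eq_zero fun v _ => ?_
  have h : ∀ x : K, kloostermanWeight ψ a b (X ^ (m + 3) +
      ∑ i, C (Fin.snocEquiv (fun _ : Fin (m + 3) => K) (x, v) i) * X ^ (i : ℕ)) =
      (if v 0 = 0 then 0 else ψ (-(b * (v 1 / v 0)))) * ψ (-a * x) := fun x => by
    rw [kloostermanWeight_X_pow_add_sum (m := m + 1)]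
    have e0 : Fin.snocEquiv (fun _ : Fin (m + 3) => K) (x, v) 0 = v 0 := by
      exact Fin.snoc_castSucc (α := fun _ => K) x v 0
    have e1 : Fin.snocEquiv (fun _ : Fin (m + 3) => K) (x, v) 1 = v 1 := by
      exact Fin.snoc_castSucc (α := fun _ => K) x v 1
    have e2 : Fin.snocEquiv (fun _ : Fin (m + 3) => K) (x, v) (Fin.last _) = x := by
      simp [Fin.snocEquiv]
    rw [e0, e1, e2, ite_mul, zero_mul, ← AddChar.map_add_eq_mul]
    congr 2
    ring
  simp_rw [h, ← mul_sum]
  rw [sum_addChar_mul hψ, if_neg (neg_ne_zero.2 ha), mul_zero]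

end KloostermanLFunction

section KloostermanExtension

open Polynomial IntermediateField

variable {K L : Type*} [Field K] [Field L] [Algebra K L]

theorem natDegree_minpoly_inv [FiniteDimensional K L] (x : L) :
    (minpoly K x⁻¹).natDegree = (minpoly K x).natDegree := by
  have h : K⟮x⁻¹⟯ = K⟮x⟯ := by
    apply le_antisymm
    · rw [adjoin_simple_le_iff]
      exact inv_mem (mem_adjoin_simple_self K x)
    · rw [adjoin_simple_le_iff]
      have := inv_mem (mem_adjoin_simple_self K x⁻¹)
      rwa [inv_inv] at this
  rw [← adjoin.finrank (.of_finite K x), ← adjoin.finrank (.of_finite K x⁻¹), h]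

theorem minpoly_inv [FiniteDimensional K L] {x : L} (hx : x ≠ 0) :
    minpoly K x⁻¹ = C ((minpoly K x).coeff 0)⁻¹ * (minpoly K x).reverse := by
  have hint : IsIntegral K x := .of_finite K x
  have h0 : (minpoly K x).coeff 0 ≠ 0 := minpoly.coeff_zero_ne_zero hint hx
  have htr : (minpoly K x).natTrailingDegree = 0 :=
    natTrailingDegree_eq_zero.2 (Or.inr h0)
  have hdeg : (minpoly K x).reverse.natDegree = (minpoly K x).natDegree := by
    rw [reverse_natDegree, htr, Nat.sub_zero]
  have hmon : (C ((minpoly K x).coeff 0)⁻¹ * (minpoly K x).reverse).Monic := by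
    rw [Monic, leadingCoeff_mul, leadingCoeff_C, reverse_leadingCoeff, trailingCoeff, htr,
      inv_mul_cancel₀ h0]
  refine (eq_of_monic_of_dvd_of_natDegree_le (minpoly.monic (.of_finite K x⁻¹)) hmon
    (minpoly.dvd K _ ?_) ?_).symm
  · let _ := invertibleOfNonzero hx
    have h := (eval₂_reverse_eq_zero_iff (algebraMap K L) x (minpoly K x)).2 (minpoly.aeval K x)
    rw [invOf_eq_inv] at h
    rw [map_mul, aeval_def, aeval_def, h, mul_zero]
  · rw [natDegree_C_mul (inv_ne_zero h0), hdeg, natDegree_minpoly_inv]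

theorem nextCoeff_minpoly_inv [FiniteDimensional K L] {x : L} (hx : x ≠ 0) :
    (minpoly K x⁻¹).nextCoeff = (minpoly K x).coeff 1 / (minpoly K x).coeff 0 := by
  have hpos : 0 < (minpoly K x⁻¹).natDegree := minpoly.natDegree_pos (.of_finite K x⁻¹)
  rw [nextCoeff_of_natDegree_pos hpos, natDegree_minpoly_inv]
  rw [natDegree_minpoly_inv] at hpos
  rw [minpoly_inv hx, coeff_C_mul, coeff_reverse, revAt_le (Nat.sub_le _ _),
    Nat.sub_sub_self hpos, div_eq_inv_mul]

theorem trace_eq_div_mul_nextCoeff [FiniteDimensional K L] (x : L) :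
    Algebra.trace K L x = ((Module.finrank K L / (minpoly K x).natDegree : ℕ) : K) *
      -(minpoly K x).nextCoeff := by
  rw [trace_eq_finrank_mul_minpoly_nextCoeff, ← Module.finrank_mul_finrank K K⟮x⟯ L,
    adjoin.finrank (.of_finite K x),
    Nat.mul_div_cancel_left _ (minpoly.natDegree_pos (.of_finite K x))]

theorem kloostermanWeight_minpoly [FiniteDimensional K L] (ψ : AddChar K ℂ) (a b : K) (x : L) :
    kloostermanWeight ψ a b (minpoly K x) ^ (Module.finrank K L / (minpoly K x).natDegree) =
      if x = 0 then 0 else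
        ψ (Algebra.trace K L (algebraMap K L a * x + algebraMap K L b * x⁻¹)) := by
  have hint : IsIntegral K x := .of_finite K x
  split_ifs with hx
  · subst hx
    rw [minpoly.zero, natDegree_X, Nat.div_one, kloostermanWeight, if_pos coeff_X_zero,
      zero_pow Module.finrank_pos.ne']
  · rw [kloostermanWeight, if_neg (minpoly.coeff_zero_ne_zero hint hx), ← Algebra.smul_def,
      ← Algebra.smul_def, map_add, map_smul, map_smul, trace_eq_div_mul_nextCoeff x,
      trace_eq_div_mul_nextCoeff x⁻¹, natDegree_minpoly_inv, nextCoeff_minpoly_inv hx,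
      ← AddChar.map_nsmul_eq_pow]
    congr 1
    rw [nsmul_eq_mul, smul_eq_mul, smul_eq_mul]
    ring

variable [Fintype K] [Fintype L]

theorem card_filter_minpoly_eq {P : K[X]} (hP : P.Monic) (hPi : Irreducible P)
    (hd : P.natDegree ∣ Module.finrank K L) :
    #{x : L | minpoly K x = P} = P.natDegree := by
  have := Fact.mk hPi
  let _ := hPi
  have : Module.Finite K (AdjoinRoot P) := (AdjoinRoot.powerBasis hPi.ne_zero).finite
  have : Finite (AdjoinRoot P) := Module.finite_of_finite K
  have hfr : Module.finrank K (AdjoinRoot P) = P.natDegree := by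
    rw [(AdjoinRoot.powerBasis hPi.ne_zero).finrank, AdjoinRoot.powerBasis_dim]
  obtain ⟨φ⟩ := FiniteField.nonempty_algHom_of_finrank_dvd (F := K) (K := AdjoinRoot P) (L := L)
    (hfr ▸ hd)
  have hroot : aeval (φ (AdjoinRoot.root P)) P = 0 := by
    rw [aeval_algHom_apply, AdjoinRoot.aeval_eq, AdjoinRoot.mk_self, map_zero]
  have hmin : ∀ x : L, aeval x P = 0 → minpoly K x = P := fun x hx =>
    (minpoly.eq_of_irreducible_of_monic hPi hx hP).symm
  have hsplit : (P.map (algebraMap K L)).Splits := by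
    rw [← hmin _ hroot]
    exact Normal.splits inferInstance _
  have hsep : P.Separable := PerfectField.separable_of_irreducible hPi
  rw [← card_rootSet_eq_natDegree hsep hsplit, ← Set.toFinset_card]
  congr 1
  ext x
  rw [mem_filter, Set.mem_toFinset, mem_rootSet]
  exact ⟨fun h => ⟨hPi.ne_zero, h.2 ▸ minpoly.aeval K x⟩, fun h => ⟨mem_univ _, hmin x h.2⟩⟩

/-- The Kloosterman sum over an extension field in terms of irreducible polynomials. -/
theorem sum_addChar_trace_eq (ψ : AddChar K ℂ) (a b : K) :
    ∑ x : L, (if x = 0 then 0 else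
      ψ (Algebra.trace K L (algebraMap K L a * x + algebraMap K L b * x⁻¹))) =
      kloostermanIrreducibleSum ψ a b (Module.finrank K L) := by
  simp_rw [← kloostermanWeight_minpoly]
  rw [kloostermanIrreducibleSum, ← sum_fiberwise_of_maps_to (g := minpoly K)
    (t := (monicIrreducibles K (Module.finrank K L)).filter
      fun P => P.natDegree ∣ Module.finrank K L)]
  · refine sum_congr rfl fun P hP => ?_
    obtain ⟨hP, hd⟩ := mem_filter.1 hP
    obtain ⟨hPm, -, hPi⟩ := mem_monicIrreducibles.1 hP
    rw [sum_congr rfl (g := fun _ => kloostermanWeight ψ a b P ^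
      (Module.finrank K L / P.natDegree)) fun x hx => by rw [(mem_filter.1 hx).2],
      sum_const, card_filter_minpoly_eq hPm hPi hd, nsmul_eq_mul]
  · intro x _
    have hint : IsIntegral K x := .of_finite K x
    have hd : (minpoly K x).natDegree ∣ Module.finrank K L := by
      rw [← adjoin.finrank hint]
      exact ⟨_, (Module.finrank_mul_finrank K K⟮x⟯ L).symm⟩
    exact mem_filter.2 ⟨mem_monicIrreducibles.2 ⟨minpoly.monic hint,
      Nat.le_of_dvd Module.finrank_pos hd, minpoly.irreducible hint⟩, hd⟩

end KloostermanExtension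

section KloostermanPointCount

open Polynomial

theorem sum_quadraticChar_eval_ge {L : Type*} [Field L] [Fintype L] {f : L[X]}
    (hf : Squarefree f) (hf0 : f.coeff 0 ≠ 0) {R : ℕ} (hR : Odd R) (hcard : Fintype.card L = R ^ 2)
    (heven : Even f.natDegree) (hpos : 0 < f.natDegree) (hle : 8 * f.natDegree + 5 ≤ R) :
    -((12 * f.natDegree + 6 : ℕ) * R : ℤ) ≤ ∑ y, quadraticChar L (f.eval y) := by
  obtain ⟨r, hr⟩ := heven
  obtain ⟨T, hT⟩ := hR
  generalize hm : f.natDegree = m at *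
  have hchar : ringChar L ≠ 2 := by
    intro h
    have h2 := (FiniteField.even_card_iff_char_two (F := L)).1 h
    rw [hcard, hT] at h2
    ring_nf at h2
    omega
  have hne : (1 : L) ≠ -1 := (Ring.neg_one_ne_one_of_char_ne_two hchar).symm
  obtain ⟨h, hh⟩ : ∃ h, 2 * h + 1 = R ^ 2 := ⟨2 * T * T + 2 * T, by rw [hT]; ring⟩
  have hmR : m < R := by omega
  have hRQ : R ≤ R ^ 2 := by nlinarith
  obtain ⟨D, hD⟩ : ∃ D, 2 * D + m + 1 = R ^ 2 := ⟨h - r, by omega⟩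
  obtain ⟨J, hJ⟩ : ∃ J, 2 * J = R + (8 * m + 5) := ⟨T + 4 * m + 3, by omega⟩
  have hst := stepanov_bound hf (hm ▸ hpos) hf0 (a := -1) (neg_ne_zero.2 one_ne_zero)
    (l := R) (J := J) (D := D) (h := h) (hcard ▸ hh) (hcard ▸ hRQ) (by rw [hm, hcard]; omega) (by
      rw [hm]
      zify at *
      have e1 : (2 * D : ℤ) = R ^ 2 - m - 1 := by linarith
      have e2 : (2 * J : ℤ) = R + (8 * m + 5) := hJ
      have : 0 < (2 * J) * (2 * D) - R * (2 * (R * m) + 2 * D + 2 * J : ℤ) := by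
        rw [e1, e2]
        have h1 : (0 : ℤ) ≤ R * (R - (8 * m + 5)) := mul_nonneg (by positivity) (by linarith)
        have h2 : (0 : ℤ) ≤ m * (R * (R - (8 * m + 5))) := mul_nonneg (by positivity) h1
        have h3 : (0 : ℤ) ≤ (m + 1) * ((R - (8 * m + 5)) * (R + 1)) := by
          have : (0 : ℤ) ≤ R - (8 * m + 5) := by linarith
          positivity
        have h4 : (0 : ℤ) < R ^ 2 := by
          have : (0 : ℤ) < R := by linarith
          positivity
        nlinarith
      linarith)
  rw [hm, hcard] at hst
  set Nn := #{y : L | f.eval y ^ h = -1}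
  have hη : ∀ y, quadraticChar L (f.eval y) =
      1 - (if f.eval y = 0 then 1 else 0) - 2 * (if f.eval y ^ h = -1 then 1 else 0) := fun y => by
    have h1 := quadraticChar_eq_pow_of_char_ne_two' hchar (f.eval y)
    rw [hcard, show R ^ 2 / 2 = h by omega] at h1
    have hh0 : h ≠ 0 := by rintro rfl; nlinarith
    by_cases h0 : f.eval y = 0
    · rw [h0, zero_pow hh0] at *
      simp
    · rw [← h1]
      rcases quadraticChar_dichotomy h0 with h2 | h2 <;> rw [h2] <;> simp [h0, hne]
  have hz : #{y : L | f.eval y = 0} ≤ m := by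
    have hf' : f ≠ 0 := by rintro rfl; simp at hf0
    rw [← hm]
    refine (card_le_card fun y hy => ?_).trans ((Multiset.toFinset_card_le _).trans (card_roots' f))
    rw [Multiset.mem_toFinset, mem_roots hf']
    exact (mem_filter.1 hy).2
  have hsum : ∑ y, quadraticChar L (f.eval y) = R ^ 2 - #{y : L | f.eval y = 0} - 2 * Nn := by
    rw [sum_congr rfl fun y _ => hη y, sum_sub_distrib, sum_sub_distrib, ← mul_sum]
    simp [hcard, Nn]
  rw [hsum]
  have hR0 : 0 < R := by omega
  zify at *
  have h1 : (R : ℤ) * (2 * Nn) ≤ R * (R ^ 2 + (11 * m + 6) * R) := by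
    have e1 : (R : ℤ) * (2 * Nn) ≤ 2 * (R * m) + 2 * D + 2 * h * m + 2 * J * R ^ 2 := by linarith
    rw [show (2 * D : ℤ) = R ^ 2 - m - 1 by linarith, show (2 * J : ℤ) = R + (8 * m + 5) from hJ,
      show (2 * h : ℤ) = R ^ 2 - 1 by linarith] at e1
    have : (0 : ℤ) ≤ R * m * (R - 1) := mul_nonneg (by positivity) (by linarith)
    nlinarith
  have h2 := le_of_mul_le_mul_left h1 hR0
  nlinarith

theorem squarefree_sq_sub_C {K L : Type*} [Field K] [Fintype K] [Field L] [Algebra K L]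
    (h2 : (2 : L) ≠ 0) {e : L} (he : e ≠ 0) :
    Squarefree ((X ^ Fintype.card K - X : L[X]) ^ 2 - C e) := by
  have hq : (Fintype.card K : L[X]) = 0 := by
    rw [← map_natCast (algebraMap L L[X]), ← map_natCast (algebraMap K L), FiniteField.cast_card_eq_zero,
      map_zero, map_zero]
  refine Separable.squarefree ?_
  have hd : derivative ((X ^ Fintype.card K - X : L[X]) ^ 2 - C e) =
      -2 * (X ^ Fintype.card K - X) := by
    rw [derivative_sub, derivative_C, derivative_pow, derivative_sub, derivative_X,
      derivative_X_pow, map_natCast C (Fintype.card K), hq]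
    rw [Nat.cast_ofNat, map_ofNat C 2]
    ring
  refine ⟨C (-e⁻¹), C (-(2 * e)⁻¹) * (X ^ Fintype.card K - X), ?_⟩
  rw [hd]
  have e1 : (C (-(2 * e)⁻¹) : L[X]) * (-2) = C (e⁻¹) := by
    rw [show (-2 : L[X]) = C (-2) by rw [C_neg]; rfl, ← C_mul]
    congr 1
    field_simp
  have e2 : (C (-e⁻¹) : L[X]) * C e = -1 := by
    rw [← C_mul, neg_mul, inv_mul_cancel₀ he, C_neg, C_1]
  have e3 : (C (-e⁻¹) : L[X]) = - C e⁻¹ := C_neg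
  linear_combination ((X ^ Fintype.card K - X : L[X]) ^ 2) * e1 - e2 +
    ((X ^ Fintype.card K - X : L[X]) ^ 2) * e3

variable {K L : Type*} [Field K] [Fintype K] [Field L] [Fintype L] [Algebra K L]

theorem sum_sum_addChar_trace {ψ : AddChar K ℂ} (hψ : ψ ≠ 1) (a b : K) :
    ∑ s : K, ∑ x : L, (if x = 0 then 0 else
      ψ (Algebra.trace K L (algebraMap K L (s * a) * x + algebraMap K L (s * b) * x⁻¹))) =
    ((Fintype.card K * #{x : L | x ≠ 0 ∧
      Algebra.trace K L (algebraMap K L a * x + algebraMap K L b * x⁻¹) = 0} : ℕ) : ℂ) := by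
  rw [sum_comm, card_filter, mul_sum, Nat.cast_sum]
  refine sum_congr rfl fun x _ => ?_
  by_cases hx : x = 0
  · simp [hx]
  simp only [hx, if_false, ne_eq, not_false_eq_true, true_and]
  set u := Algebra.trace K L (algebraMap K L a * x + algebraMap K L b * x⁻¹) with hu
  have h : ∀ s : K, Algebra.trace K L (algebraMap K L (s * a) * x + algebraMap K L (s * b) * x⁻¹)
      = u * s := fun s => by
    rw [hu, mul_comm _ s, ← smul_eq_mul s (Algebra.trace K L _), ← LinearMap.map_smul, Algebra.smul_def,
      map_mul (algebraMap K L), map_mul (algebraMap K L)]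
    congr 1
    ring
  simp_rw [h]
  rw [sum_addChar_mul hψ]
  push_cast
  split_ifs <;> simp

theorem card_pow_card_sub_eq_le (u : L) :
    #{y : L | y ^ Fintype.card K - y = u} ≤
      if Algebra.trace K L u = 0 then Fintype.card K else 0 := by
  split_ifs with h
  · have hq := Fintype.one_lt_card (α := K)
    have hd : (X ^ Fintype.card K - X - C u : L[X]).natDegree = Fintype.card K := by
      rw [natDegree_sub_C, FiniteField.X_pow_card_sub_X_natDegree_eq L hq]
    have h0 : (X ^ Fintype.card K - X - C u : L[X]) ≠ 0 := by
      intro h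
      rw [h, natDegree_zero] at hd
      omega
    refine le_trans ?_ hd.le
    refine (card_le_card fun y hy => ?_).trans ((Multiset.toFinset_card_le _).trans (card_roots' _))
    rw [Multiset.mem_toFinset, mem_roots h0]
    simp [IsRoot, (mem_filter.1 hy).2]
  · rw [Nat.le_zero, card_eq_zero, filter_eq_empty_iff]
    rintro y - rfl
    refine h ?_
    have := Algebra.trace_eq_of_algEquiv (FiniteField.frobeniusAlgEquivOfAlgebraic K L) y
    rw [FiniteField.coe_frobeniusAlgEquivOfAlgebraic] at this
    rw [map_sub, this, sub_self]

theorem quadraticChar_add_one_le_card (h2 : ringChar L ≠ 2) {a b : L} (ha : a ≠ 0) (hb : b ≠ 0)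
    (w : L) : quadraticChar L (w ^ 2 - 4 * (a * b)) + 1 ≤
      #{x : L | x ≠ 0 ∧ w = a * x + b * x⁻¹} := by
  have h2' : (2 : L) ≠ 0 := Ring.two_ne_zero h2
  rw [← quadraticChar_card_sqrts h2, Nat.cast_le]
  refine card_le_card_of_injOn (fun s => (s + w) / (2 * a)) ?_ ?_
  · intro s hs
    have hs : s ^ 2 = w ^ 2 - 4 * (a * b) := by simpa using hs
    have hx : (s + w) / (2 * a) ≠ 0 := by
      intro h
      have : s + w = 0 := by
        rcases div_eq_zero_iff.1 h with h | h
        · exact h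
        · exact absurd h (mul_ne_zero h2' ha)
      have h4 : (2 : L) * 2 * (a * b) = 0 := by
        linear_combination hs - (s - w) * this
      exact mul_ne_zero (mul_ne_zero h2' h2') (mul_ne_zero ha hb) h4
    have hsw : s + w ≠ 0 := fun h => hx (by rw [h, zero_div])
    simp only [coe_filter, mem_univ, true_and, Set.mem_ofPred_eq]
    refine ⟨hx, ?_⟩
    field_simp
    linear_combination -hs
  · intro s _ s' _ h
    have := (div_left_inj' (mul_ne_zero h2' ha)).1 h
    exact add_right_cancel this

theorem card_add_sum_quadraticChar_le (h2 : ringChar L ≠ 2) {a b : K} (ha : a ≠ 0) (hb : b ≠ 0) :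
    (Fintype.card L : ℤ) + ∑ y : L, quadraticChar L
      (((X ^ Fintype.card K - X) ^ 2 - C (4 * (algebraMap K L a * algebraMap K L b))).eval y) ≤
    (Fintype.card K * #{x : L | x ≠ 0 ∧
      Algebra.trace K L (algebraMap K L a * x + algebraMap K L b * x⁻¹) = 0} : ℕ) := by
  have ha' : algebraMap K L a ≠ 0 := (_root_.map_ne_zero _).2 ha
  have hb' : algebraMap K L b ≠ 0 := (_root_.map_ne_zero _).2 hb
  calc _ = ∑ y : L, (quadraticChar L
        ((y ^ Fintype.card K - y) ^ 2 - 4 * (algebraMap K L a * algebraMap K L b)) + 1) := by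
        rw [sum_add_distrib, add_comm]
        simp
    _ ≤ ∑ y : L, (#{x : L | x ≠ 0 ∧
          y ^ Fintype.card K - y = algebraMap K L a * x + algebraMap K L b * x⁻¹} : ℤ) :=
        sum_le_sum fun y _ => quadraticChar_add_one_le_card h2 ha' hb' _
    _ = ((∑ x : L, if x ≠ 0 then #{y : L |
          y ^ Fintype.card K - y = algebraMap K L a * x + algebraMap K L b * x⁻¹} else 0 : ℕ) : ℤ) := by
        simp_rw [card_filter]
        push_cast
        rw [sum_comm]
        refine sum_congr rfl fun x _ => ?_
        by_cases hx : x = 0 <;> simp [hx]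
    _ ≤ _ := by
        rw [Nat.cast_le, card_filter, mul_sum]
        refine sum_le_sum fun x _ => ?_
        by_cases hx : x = 0
        · simp [hx]
        · simp only [hx, ne_eq, not_false_eq_true, if_true, true_and]
          refine (card_pow_card_sub_eq_le _).trans ?_
          split_ifs <;> simp

end KloostermanPointCount

section KloostermanBound

theorem exists_add_eq_mul_eq (t : ℝ) {q : ℝ} (hq : 0 < q) :
    ∃ α β : ℂ, α + β = t ∧ α * β = q ∧
      (∀ m : ℕ, -2 * q ^ m ≤ (α ^ (2 * m) + β ^ (2 * m)).re) ∧
      (4 * q < t ^ 2 → ∃ ρ > q, ∀ m : ℕ, ρ ^ m ≤ (α ^ (2 * m) + β ^ (2 * m)).re) := by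
  rcases le_or_gt (t ^ 2) (4 * q) with h | h
  · have hs := Real.sq_sqrt (sub_nonneg.2 h)
    set s := √(4 * q - t ^ 2)
    have hnorm : ∀ z : ℂ, Complex.normSq z = q → ∀ m : ℕ, -q ^ m ≤ (z ^ (2 * m)).re :=
      fun z hz m => by
        have h1 := (abs_le.1 (Complex.abs_re_le_norm (z ^ (2 * m)))).1
        rwa [norm_pow, pow_mul, ← Complex.normSq_eq_norm_sq, hz] at h1
    refine ⟨⟨t / 2, s / 2⟩, ⟨t / 2, -(s / 2)⟩, ?_, ?_, fun m => ?_, fun h' => absurd h h'.not_ge⟩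
    · apply Complex.ext <;> simp
    · apply Complex.ext
      · simp
        linarith
      · simp
        ring
    · have h1 := hnorm ⟨t / 2, s / 2⟩ (by rw [Complex.normSq_mk]; linarith) m
      have h2 := hnorm ⟨t / 2, -(s / 2)⟩ (by rw [Complex.normSq_mk]; linarith) m
      rw [Complex.add_re]
      linarith
  · have hs := Real.sq_sqrt (sub_nonneg.2 h.le)
    have hs0 := Real.sqrt_nonneg (t ^ 2 - 4 * q)
    set s := √(t ^ 2 - 4 * q)
    have hre : ∀ m : ℕ, ((((t + s) / 2 : ℝ) : ℂ) ^ (2 * m) + (((t - s) / 2 : ℝ) : ℂ) ^ (2 * m)).re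
        = (((t + s) / 2) ^ 2) ^ m + (((t - s) / 2) ^ 2) ^ m := fun m => by
      rw [← Complex.ofReal_pow, ← Complex.ofReal_pow, ← Complex.ofReal_add, Complex.ofReal_re,
        pow_mul, pow_mul]
    refine ⟨((t + s) / 2 : ℝ), ((t - s) / 2 : ℝ), ?_, ?_, fun m => ?_, fun _ => ?_⟩
    · push_cast
      ring
    · rw [← Complex.ofReal_mul]
      congr 1
      linarith
    · rw [hre]
      have : 0 < q ^ m := by positivity
      have : 0 ≤ (((t + s) / 2) ^ 2) ^ m := by positivity
      have : 0 ≤ (((t - s) / 2) ^ 2) ^ m := by positivity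
      linarith
    · rcases le_total 0 t with ht | ht
      · refine ⟨((t + s) / 2) ^ 2, by nlinarith, fun m => ?_⟩
        rw [hre]
        exact le_add_of_nonneg_right (by positivity)
      · refine ⟨((t - s) / 2) ^ 2, by nlinarith, fun m => ?_⟩
        rw [hre]
        exact le_add_of_nonneg_left (by positivity)

variable {K : Type*} [Field K] [Fintype K]

theorem kloostermanIrreducibleSum_eq_neg {ψ : AddChar K ℂ} (hψ : ψ ≠ 1) {a b : K} (ha : a ≠ 0)
    (hb : b ≠ 0) {α β : ℂ} (h1 : α + β = -kloostermanLCoeff ψ a b 1)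
    (h2 : α * β = Fintype.card K) (n : ℕ) (hn : 0 < n) :
    kloostermanIrreducibleSum ψ a b n = -(α ^ n + β ^ n) := by
  have hS0 := kloostermanLCoeff_zero ψ a b
  have hS2 := kloostermanLCoeff_two hψ ha hb
  induction n using Nat.strong_induction_on with
  | _ n ih =>
    have hN := natCast_mul_kloostermanLCoeff ψ a b n
    match n, hn with
    | 1, _ =>
      simp only [Nat.cast_one, one_mul, Icc_self, sum_singleton, Nat.sub_self, hS0, mul_one] at hN
      rw [← hN]
      linear_combination h1
    | 2, _ =>
      rw [sum_Icc_succ_top (by norm_num), Icc_self, sum_singleton, ih 1 (by norm_num) (by norm_num)]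
        at hN
      simp only [Nat.reduceAdd, Nat.sub_self, hS0, hS2, Nat.reduceSub, Nat.cast_ofNat] at hN
      linear_combination -hN + (α + β) * h1 - 2 * h2
    | j + 3, _ =>
      rw [sum_Icc_succ_top (by omega), sum_Icc_succ_top (by omega), sum_Icc_succ_top (by omega),
        sum_eq_zero fun i hi => by
          rw [kloostermanLCoeff_eq_zero hψ ha (by rw [mem_Icc] at hi; omega), mul_zero],
        kloostermanLCoeff_eq_zero hψ ha (by omega), Nat.sub_self, hS0,
        show j + 3 - (j + 1) = 2 by omega, show j + 3 - (j + 1 + 1) = 1 by omega, hS2,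
        ih (j + 1) (by omega) (by omega), ih (j + 1 + 1) (by omega) (by omega)] at hN
      linear_combination -hN + (α ^ (j + 2) + β ^ (j + 2)) * h1 -
        (α ^ (j + 1) + β ^ (j + 1)) * h2

/-- The Kloosterman sum. -/
noncomputable def kloostermanSum (ψ : AddChar K ℂ) (a b : K) : ℂ :=
  ∑ x, if x = 0 then 0 else ψ (a * x + b * x⁻¹)

theorem conj_kloostermanSum (ψ : AddChar K ℂ) (a b : K) :
    (starRingEnd ℂ) (kloostermanSum ψ a b) = kloostermanSum ψ a b := by
  rw [kloostermanSum, map_sum]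
  refine Fintype.sum_equiv (Equiv.neg K) _ _ fun x => ?_
  rw [Equiv.neg_apply, neg_eq_zero]
  split_ifs
  · exact map_zero _
  · rw [← AddChar.map_neg_eq_conj]
    congr 1
    rw [inv_neg]
    ring

/-- **Weil's bound** for Kloosterman sums. -/
theorem sq_re_kloostermanSum_le (hK : ringChar K ≠ 2) {ψ : AddChar K ℂ} (hψ : ψ ≠ 1) {a b : K}
    (ha : a ≠ 0) (hb : b ≠ 0) : (kloostermanSum ψ a b).re ^ 2 ≤ 4 * Fintype.card K := by
  by_contra! hlt
  set q := Fintype.card K with hq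
  have hq1 : 1 < q := Fintype.one_lt_card
  have hqpos : (0 : ℝ) < q := by positivity
  have hqodd : Odd q := by
    rw [Nat.odd_iff]
    have := (FiniteField.even_card_iff_char_two (F := K)).not.1 hK
    omega
  choose α β hsum hprod hlow hhigh using
    fun s : K => exists_add_eq_mul_eq (-(kloostermanSum ψ (s * a) (s * b)).re) hqpos
  have hreal : ∀ a b : K, ((kloostermanSum ψ a b).re : ℂ) = kloostermanSum ψ a b := fun a b =>
    Complex.conj_eq_iff_re.1 (conj_kloostermanSum ψ a b)
  have hc : ∀ s : K, s ≠ 0 → ∀ n : ℕ, 0 < n →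
      kloostermanIrreducibleSum ψ (s * a) (s * b) n = -(α s ^ n + β s ^ n) := fun s hs =>
    kloostermanIrreducibleSum_eq_neg hψ (mul_ne_zero hs ha) (mul_ne_zero hs hb)
      (by rw [hsum, Complex.ofReal_neg, hreal, kloostermanLCoeff_one]; rfl)
      (by rw [hprod]; simp [hq])
  obtain ⟨ρ, hρ, hρm⟩ := hhigh 1 (by simpa using hlt)
  obtain ⟨p, hp⟩ := CharP.exists K
  have : Fact p.Prime := ⟨CharP.char_is_prime K p⟩
  have key : ∀ m : ℕ, 0 < m → 8 * (2 * q) + 5 ≤ q ^ m →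
      ρ ^ m ≤ ((12 * (2 * q) + 6 : ℕ) + 2 * q) * (q : ℝ) ^ m := fun m hm hqm => by
    have : NeZero (2 * m) := ⟨by omega⟩
    let L := FiniteField.Extension K p (2 * m)
    have : Fintype L := Fintype.ofFinite L
    have hfr : Module.finrank K L = 2 * m := FiniteField.finrank_extension K p (2 * m)
    have hcard : Fintype.card L = (q ^ m) ^ 2 := by
      rw [← Nat.card_eq_fintype_card, FiniteField.natCard_extension, Nat.card_eq_fintype_card,
        ← pow_mul, mul_comm]
    have hL : ringChar L ≠ 2 := fun h => by
      have h1 := FiniteField.even_card_iff_char_two.1 h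
      rw [hcard] at h1
      have h2 := Nat.odd_iff.1 ((hqodd.pow (n := m)).pow (n := 2))
      omega
    have hab : 4 * (algebraMap K L a * algebraMap K L b) ≠ 0 := by
      have h2 : (2 : L) ≠ 0 := Ring.two_ne_zero hL
      have : (4 : L) = 2 * 2 := by norm_num
      rw [this]
      exact mul_ne_zero (mul_ne_zero h2 h2) (mul_ne_zero ((_root_.map_ne_zero _).2 ha)
        ((_root_.map_ne_zero _).2 hb))
    have hdeg : ((Polynomial.X ^ q - Polynomial.X : Polynomial L) ^ 2 -
        Polynomial.C (4 * (algebraMap K L a * algebraMap K L b))).natDegree = 2 * q := by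
      rw [Polynomial.natDegree_sub_C, Polynomial.natDegree_pow,
        FiniteField.X_pow_card_sub_X_natDegree_eq L hq1]
    have hA := sum_quadraticChar_eval_ge (squarefree_sq_sub_C (K := K) (Ring.two_ne_zero hL) hab)
      (by
        simp only [Polynomial.coeff_zero_eq_eval_zero]
        simpa [Fintype.card_ne_zero] using hab) (hqodd.pow (n := m)) hcard
      (by rw [hdeg]; exact even_two_mul q) (by rw [hdeg]; omega) (by rw [hdeg]; exact hqm)
    rw [hdeg] at hA
    have hB := card_add_sum_quadraticChar_le (L := L) hL ha hb
    have hC := sum_sum_addChar_trace (L := L) hψ a b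
    simp_rw [sum_addChar_trace_eq, hfr] at hC
    have h0 : kloostermanIrreducibleSum ψ (0 * a) (0 * b) (2 * m) = ((q : ℂ) ^ m) ^ 2 - 1 := by
      rw [← hfr, ← sum_addChar_trace_eq]
      have h1 : 1 ≤ (q ^ m) ^ 2 := Nat.one_le_pow _ _ (Nat.pow_pos (by omega))
      simp [sum_ite, filter_ne', hcard, Nat.cast_sub h1]
    rw [← sum_erase_add _ _ (mem_univ (0 : K)), h0,
      sum_congr rfl fun s hs => hc s (ne_of_mem_erase hs) (2 * m) (by omega)] at hC
    have hD := congrArg Complex.re hC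
    rw [Complex.add_re, Complex.re_sum, Complex.natCast_re, ← Nat.cast_pow, ← Nat.cast_pow,
      Complex.sub_re, Complex.natCast_re, Complex.one_re] at hD
    simp_rw [Complex.neg_re] at hD
    rw [sum_neg_distrib] at hD
    have hE := hA.trans (le_sub_iff_add_le'.2 hB)
    rw [hcard] at hE
    have hE' := (Int.cast_le (R := ℝ)).2 hE
    push_cast at hE' hD ⊢
    have h1 := single_le_sum (s := univ.erase (0 : K))
      (f := fun s => (α s ^ (2 * m) + β s ^ (2 * m)).re + 2 * (q : ℝ) ^ m)
      (fun s _ => by linarith [hlow s m]) (mem_erase.2 ⟨one_ne_zero, mem_univ (1 : K)⟩)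
    rw [sum_add_distrib, sum_const, card_erase_of_mem (mem_univ _), card_univ, ← hq, nsmul_eq_mul,
      Nat.cast_sub hq1.le, Nat.cast_one] at h1
    have h2 := hρm m
    have h3 : 0 < (q : ℝ) ^ m := by positivity
    rw [← hq] at hE'
    nlinarith
  have h1 := (tendsto_pow_atTop_atTop_of_one_lt ((one_lt_div hqpos).2 hρ)).eventually_gt_atTop
    (((12 * (2 * q) + 6 : ℕ) + 2 * q : ℝ))
  have h2 := (tendsto_pow_atTop_atTop_of_one_lt hq1).eventually_ge_atTop (8 * (2 * q) + 5)
  obtain ⟨m, h1, h2, h3⟩ := (h1.and (h2.and (Filter.eventually_gt_atTop 0))).exists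
  rw [div_pow, lt_div_iff₀ (by positivity)] at h1
  exact (key m h3 h2).not_gt h1

theorem norm_kloostermanSum_le (hK : ringChar K ≠ 2) {ψ : AddChar K ℂ} (hψ : ψ ≠ 1) {a b : K}
    (ha : a ≠ 0) (hb : b ≠ 0) : ‖kloostermanSum ψ a b‖ ≤ 2 * √(Fintype.card K) := by
  have h := sq_re_kloostermanSum_le hK hψ ha hb
  rw [← Complex.conj_eq_iff_re.1 (conj_kloostermanSum ψ a b), Complex.norm_real, Real.norm_eq_abs]
  refine abs_le_of_sq_le_sq (h.trans_eq ?_) (by positivity)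
  rw [mul_pow, Real.sq_sqrt (by positivity)]
  norm_num

end KloostermanBound

section SphereTransform

variable {K : Type*} [Field K] [Fintype K]

variable (K) in
/-- The quadratic character with complex values. -/
noncomputable def complexQuadraticChar : MulChar K ℂ :=
  (quadraticChar K).ringHomComp (Int.castRingHom ℂ)

theorem complexQuadraticChar_sq {t : K} (ht : t ≠ 0) : complexQuadraticChar K t ^ 2 = 1 := by
  have h := quadraticChar_sq_one ht
  simp only [complexQuadraticChar, MulChar.ringHomComp_apply, eq_intCast]
  exact_mod_cast h

theorem gaussSum_complexQuadraticChar_sq (hK : ringChar K ≠ 2) {ψ : AddChar K ℂ} (hψ : ψ ≠ 1) :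
    gaussSum (complexQuadraticChar K) ψ ^ 2 = complexQuadraticChar K (-1) * Fintype.card K := by
  refine gaussSum_sq ?_ ?_ (AddChar.IsPrimitive.of_ne_one hψ)
  · exact (MulChar.ringHomComp_ne_one_iff Int.cast_injective).2 (quadraticChar_ne_one hK)
  · exact (quadraticChar_isQuadratic K).comp _

/-- The quadratic Gauss sum. -/
noncomputable def quadraticGaussSum (ψ : AddChar K ℂ) (t : K) : ℂ := ∑ x, ψ (t * x ^ 2)

theorem card_sq_eq (hK : ringChar K ≠ 2) (y : K) :
    (#{x : K | x ^ 2 = y} : ℂ) = complexQuadraticChar K y + 1 := by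
  have h := quadraticChar_card_sqrts hK y
  rw [show {x : K | x ^ 2 = y}.toFinset = ({x : K | x ^ 2 = y} : Finset K) by ext; simp] at h
  simp only [complexQuadraticChar, MulChar.ringHomComp_apply, eq_intCast]
  exact_mod_cast h

theorem card_sq_eq_le (hK : ringChar K ≠ 2) (y : K) : #{x : K | x ^ 2 = y} ≤ 2 := by
  have h := quadraticChar_card_sqrts hK y
  rw [show {x : K | x ^ 2 = y}.toFinset = ({x : K | x ^ 2 = y} : Finset K) by ext; simp] at h
  by_cases hy : y = 0
  · rw [hy, quadraticChar_zero] at h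
    rw [hy]
    omega
  · rcases quadraticChar_dichotomy hy with h1 | h1 <;> omega

theorem quadraticGaussSum_eq (hK : ringChar K ≠ 2) {ψ : AddChar K ℂ} (hψ : ψ ≠ 1) {t : K}
    (ht : t ≠ 0) : quadraticGaussSum ψ t =
      complexQuadraticChar K t * gaussSum (complexQuadraticChar K) ψ := by
  have h1 : quadraticGaussSum ψ t = ∑ y, (complexQuadraticChar K y + 1) * ψ (t * y) := by
    rw [quadraticGaussSum, ← sum_fiberwise (g := fun x : K => x ^ 2)]
    refine sum_congr rfl fun y _ => ?_
    rw [sum_congr rfl (g := fun _ => ψ (t * y)) fun x hx => by rw [(mem_filter.1 hx).2],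
      sum_const, nsmul_eq_mul, card_sq_eq hK]
  simp_rw [add_mul, one_mul] at h1
  rw [sum_add_distrib, sum_addChar_mul hψ, if_neg ht, add_zero] at h1
  rw [h1, ← gaussSum_mulShift _ _ (Units.mk0 t ht), ← mul_assoc, Units.val_mk0, ← pow_two,
    complexQuadraticChar_sq ht, one_mul]
  rfl

theorem norm_complexQuadraticChar {t : K} (ht : t ≠ 0) : ‖complexQuadraticChar K t‖ = 1 := by
  have h := congrArg norm (complexQuadraticChar_sq ht)
  rw [norm_pow, norm_one] at h
  exact (pow_eq_one_iff_of_nonneg (norm_nonneg _) two_ne_zero).1 h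

theorem quadraticGaussSum_sq (hK : ringChar K ≠ 2) {ψ : AddChar K ℂ} (hψ : ψ ≠ 1) {t : K}
    (ht : t ≠ 0) :
    quadraticGaussSum ψ t ^ 2 = complexQuadraticChar K (-1) * Fintype.card K := by
  rw [quadraticGaussSum_eq hK hψ ht, mul_pow, complexQuadraticChar_sq ht, one_mul,
    gaussSum_complexQuadraticChar_sq hK hψ]

theorem quadraticGaussSum_mul (hK : ringChar K ≠ 2) {ψ : AddChar K ℂ} (hψ : ψ ≠ 1) {s t : K}
    (hs : s ≠ 0) (ht : t ≠ 0) :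
    quadraticGaussSum ψ (s * t) = complexQuadraticChar K s * quadraticGaussSum ψ t := by
  rw [quadraticGaussSum_eq hK hψ ht, quadraticGaussSum_eq hK hψ (mul_ne_zero hs ht), map_mul,
    mul_assoc]

theorem sum_addChar_quadratic (hK : ringChar K ≠ 2) (ψ : AddChar K ℂ) {t : K} (ht : t ≠ 0)
    (m : K) :
    ∑ x, ψ (t * x ^ 2 + m * x) = quadraticGaussSum ψ t * ψ (-(m ^ 2 / 4) * t⁻¹) := by
  have h2 : (2 : K) ≠ 0 := Ring.two_ne_zero hK
  rw [quadraticGaussSum, sum_mul]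
  refine Fintype.sum_equiv (Equiv.addRight (m / (2 * t))) _ _ fun x => ?_
  rw [← AddChar.map_add_eq_mul, Equiv.coe_addRight]
  congr 1
  have h4 : (4 : K) = 2 * 2 := by norm_num
  rw [h4]
  field_simp
  ring

theorem sum_ne_zero_addChar {ψ : AddChar K ℂ} (hψ : ψ ≠ 1) (u : K) :
    ∑ t, (if t = 0 then 0 else ψ (u * t)) = (if u = 0 then (Fintype.card K : ℂ) else 0) - 1 := by
  rw [← sum_addChar_mul hψ u, ← sum_erase_add _ _ (mem_univ (0 : K)),
    ← sum_erase_add (a := (0 : K)) univ (fun x => ψ (u * x)) (mem_univ _)]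
  simp only [if_true, add_zero, mul_zero, AddChar.map_zero_eq_one, add_sub_cancel_right]
  exact sum_congr rfl fun t ht => if_neg (ne_of_mem_erase ht)

/-- The bound for Salié sums, normalised by the quadratic Gauss sum. -/
theorem norm_salie_le (hK : ringChar K ≠ 2) {ψ : AddChar K ℂ} (hψ : ψ ≠ 1) (a b : K) :
    ‖∑ t, (if t = 0 then 0 else quadraticGaussSum ψ t * ψ (a * t + b * t⁻¹))‖ ≤
      2 * Fintype.card K := by
  by_cases hb : b = 0
  · have h1 : ∀ t : K, (if t = 0 then 0 else quadraticGaussSum ψ t * ψ (a * t + b * t⁻¹)) =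
        ∑ x, if t = 0 then 0 else ψ ((x ^ 2 + a) * t) := fun t => by
      split_ifs with ht
      · simp
      · rw [hb, quadraticGaussSum, sum_mul]
        refine sum_congr rfl fun x _ => ?_
        rw [← AddChar.map_add_eq_mul]
        congr 1
        ring
    simp_rw [h1]
    rw [sum_comm]
    simp_rw [sum_ne_zero_addChar hψ]
    rw [sum_sub_distrib, ← sum_filter, sum_const, sum_const, nsmul_eq_mul, nsmul_eq_mul, mul_one,
      card_univ]
    have h2 : #{x : K | x ^ 2 + a = 0} ≤ 2 := by
      simpa only [add_eq_zero_iff_eq_neg] using card_sq_eq_le hK (-a)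
    have h3 : (0 : ℝ) ≤ Fintype.card K := by positivity
    rw [show (#{x : K | x ^ 2 + a = 0} : ℂ) * Fintype.card K - Fintype.card K =
      (((#{x : K | x ^ 2 + a = 0} : ℝ) - 1) * Fintype.card K : ℝ) by push_cast; ring,
      Complex.norm_real, Real.norm_eq_abs, abs_mul, abs_of_nonneg h3]
    refine mul_le_mul_of_nonneg_right ?_ h3
    have h4 : (#{x : K | x ^ 2 + a = 0} : ℝ) ≤ 2 := by exact_mod_cast h2
    have h5 : (0 : ℝ) ≤ #{x : K | x ^ 2 + a = 0} := by positivity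
    rw [abs_le]
    constructor <;> linarith
  · have h2 : (2 : K) ≠ 0 := Ring.two_ne_zero hK
    have h4' : (4 : K) = 2 * 2 := by norm_num
    have h4 : (4 : K) ≠ 0 := h4' ▸ mul_ne_zero h2 h2
    have hs : -(4 * b) ≠ 0 := neg_ne_zero.2 (mul_ne_zero h4 hb)
    have h1 : ∑ t, (if t = 0 then 0 else quadraticGaussSum ψ t * ψ (a * t + b * t⁻¹)) =
        complexQuadraticChar K (-(4 * b)) *
          ∑ x, ψ x * ((if x ^ 2 - 4 * a * b = 0 then (Fintype.card K : ℂ) else 0) - 1) := by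
      simp_rw [← sum_ne_zero_addChar hψ, mul_sum]
      rw [sum_comm]
      refine (Fintype.sum_equiv (Equiv.mulLeft₀ _ hs) _ _ fun t => ?_).symm
      rw [Equiv.mulLeft₀_apply]
      by_cases ht : t = 0
      · simp [ht]
      rw [if_neg (mul_ne_zero hs ht), quadraticGaussSum_mul hK hψ hs ht,
        mul_assoc (complexQuadraticChar K _),
        ← mul_sum]
      congr 1
      have h3 : a * (-(4 * b) * t) + b * (-(4 * b) * t)⁻¹ =
          -(1 ^ 2 / 4) * t⁻¹ + -(4 * a * b) * t := by
        field_simp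
        ring
      rw [h3, AddChar.map_add_eq_mul, ← mul_assoc, ← sum_addChar_quadratic hK ψ ht, sum_mul]
      refine sum_congr rfl fun x _ => ?_
      rw [if_neg ht, ← AddChar.map_add_eq_mul, ← AddChar.map_add_eq_mul]
      congr 1
      ring
    rw [h1, norm_mul, norm_complexQuadraticChar hs, one_mul]
    have h5 : ∑ x, ψ x = 0 := AddChar.sum_eq_zero_of_ne_one hψ
    simp_rw [mul_sub, mul_one]
    rw [sum_sub_distrib, h5, sub_zero]
    simp_rw [mul_ite, mul_zero]
    rw [← sum_filter]
    refine (norm_sum_le _ _).trans ?_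
    simp_rw [norm_mul, AddChar.norm_apply, one_mul, Complex.norm_natCast]
    rw [sum_const, nsmul_eq_mul]
    refine mul_le_mul_of_nonneg_right ?_ (by positivity)
    simp_rw [sub_eq_zero]
    exact_mod_cast card_sq_eq_le hK _

theorem norm_sum_quadraticGaussSum_pow_le (hK : ringChar K ≠ 2) {ψ : AddChar K ℂ} (hψ : ψ ≠ 1)
    {a : K} (ha : a ≠ 0) (b : K) (d : ℕ) :
    ‖∑ t, (if t = 0 then 0 else quadraticGaussSum ψ t ^ d * ψ (a * t + b * t⁻¹))‖ ≤
      2 * √(Fintype.card K) ^ (d + 1) := by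
  have hq := Real.sq_sqrt (Nat.cast_nonneg (α := ℝ) (Fintype.card K))
  have h1q : 1 ≤ √(Fintype.card K : ℝ) :=
    Real.one_le_sqrt.2 (by exact_mod_cast Fintype.card_pos)
  set r := √(Fintype.card K : ℝ)
  have hG : ‖(complexQuadraticChar K (-1) * Fintype.card K : ℂ)‖ = r ^ 2 := by
    rw [norm_mul, norm_complexQuadraticChar (neg_ne_zero.2 one_ne_zero), one_mul,
      Complex.norm_natCast, hq]
  rcases Nat.even_or_odd' d with ⟨e, rfl | rfl⟩
  · have h1 : ∀ t : K, (if t = 0 then 0 else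
        quadraticGaussSum ψ t ^ (2 * e) * ψ (a * t + b * t⁻¹)) =
        (complexQuadraticChar K (-1) * Fintype.card K) ^ e *
          if t = 0 then 0 else ψ (a * t + b * t⁻¹) := fun t => by
      split_ifs with ht
      · simp
      · rw [pow_mul, quadraticGaussSum_sq hK hψ ht]
    simp_rw [h1]
    rw [← mul_sum, norm_mul, norm_pow, hG, pow_succ r (2 * e), pow_mul, mul_left_comm]
    refine mul_le_mul_of_nonneg_left ?_ (by positivity)
    by_cases hb : b = 0
    · simp_rw [hb, zero_mul, add_zero]
      rw [sum_ne_zero_addChar hψ, if_neg ha, zero_sub, norm_neg, norm_one]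
      linarith
    · exact norm_kloostermanSum_le hK hψ ha hb
  · have h1 : ∀ t : K, (if t = 0 then 0 else
        quadraticGaussSum ψ t ^ (2 * e + 1) * ψ (a * t + b * t⁻¹)) =
        (complexQuadraticChar K (-1) * Fintype.card K) ^ e *
          if t = 0 then 0 else quadraticGaussSum ψ t * ψ (a * t + b * t⁻¹) := fun t => by
      split_ifs with ht
      · simp
      · rw [pow_succ, pow_mul, quadraticGaussSum_sq hK hψ ht, mul_assoc]
    simp_rw [h1]
    rw [← mul_sum, norm_mul, norm_pow, hG, add_assoc, pow_add, pow_mul, mul_left_comm]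
    refine mul_le_mul_of_nonneg_left ?_ (by positivity)
    rw [show 1 + 1 = 2 from rfl, hq]
    exact norm_salie_le hK hψ a b

theorem addChar_sum_eq_prod {A ι : Type*} [AddCommMonoid A] (ψ : AddChar A ℂ) (s : Finset ι)
    (g : ι → A) :
    ψ (∑ i ∈ s, g i) = ∏ i ∈ s, ψ (g i) := by
  induction s using Finset.induction_on with
  | empty => simp
  | insert i s hi ih => rw [sum_insert hi, prod_insert hi, AddChar.map_add_eq_mul, ih]

/-- The kernel of the normalised sphere of radius `c` minus the uniform measure. -/
noncomputable def sphereKernel {d : ℕ} (c : K) (z : Fin d → K) : ℝ :=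
  (if ∑ i, z i ^ 2 = c then (Fintype.card K : ℝ) else 0) - 1

theorem norm_sum_sphereKernel_mul_le (hK : ringChar K ≠ 2) {ψ : AddChar K ℂ} (hψ : ψ ≠ 1)
    {c : K} (hc : c ≠ 0) {d : ℕ} (m : Fin d → K) :
    ‖∑ z : Fin d → K, (sphereKernel c z : ℂ) * ψ (∑ i, m i * z i)‖ ≤
      2 * √(Fintype.card K) ^ (d + 1) := by
  refine le_of_eq_of_le (congrArg norm ?_)
    (norm_sum_quadraticGaussSum_pow_le hK hψ (neg_ne_zero.2 hc) (-((∑ i, m i ^ 2) / 4)) d)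
  have h1 : ∀ z : Fin d → K, (sphereKernel c z : ℂ) =
      ∑ t, if t = 0 then 0 else ψ ((∑ i, z i ^ 2 - c) * t) := fun z => by
    rw [sum_ne_zero_addChar hψ, sphereKernel]
    simp only [sub_eq_zero]
    split_ifs <;> simp
  simp_rw [h1, sum_mul]
  rw [sum_comm]
  refine sum_congr rfl fun t _ => ?_
  by_cases ht : t = 0
  · simp [ht]
  simp only [ht, if_false]
  have h2 : ∀ z : Fin d → K, ψ ((∑ i, z i ^ 2 - c) * t) * ψ (∑ i, m i * z i) =
      ψ (-c * t) * ∏ i, ψ (t * z i ^ 2 + m i * z i) := fun z => by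
    rw [← addChar_sum_eq_prod, ← AddChar.map_add_eq_mul, ← AddChar.map_add_eq_mul,
      sum_add_distrib, ← mul_sum]
    congr 1
    ring
  simp_rw [h2]
  rw [← mul_sum, ← Fintype.piFinset_univ, ← prod_univ_sum (fun _ => univ)
    (fun i x => ψ (t * x ^ 2 + m i * x))]
  simp_rw [sum_addChar_quadratic hK ψ ht]
  rw [prod_mul_distrib, prod_const, card_univ, Fintype.card_fin, ← addChar_sum_eq_prod,
    mul_left_comm, ← AddChar.map_add_eq_mul, ← sum_mul, sum_neg_distrib, sum_div]

end SphereTransform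

section SphereOperator

variable {K : Type*} [Field K] [Fintype K] {d : ℕ}

theorem sum_addChar_dotProduct {ψ : AddChar K ℂ} (hψ : ψ ≠ 1) (u : Fin d → K) :
    ∑ m : Fin d → K, ψ (∑ i, m i * u i) = if u = 0 then (Fintype.card K : ℂ) ^ d else 0 := by
  simp_rw [addChar_sum_eq_prod]
  rw [← Fintype.piFinset_univ, ← prod_univ_sum (fun _ => univ) (fun i x => ψ (x * u i))]
  simp_rw [mul_comm _ (u _), sum_addChar_mul hψ]
  split_ifs with h
  · simp [h]
  · obtain ⟨i, hi⟩ := Function.ne_iff.1 h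
    exact prod_eq_zero (mem_univ i) (if_neg hi)

/-- The Fourier transform of a real function on `K ^ d`. -/
noncomputable def finiteFourier (ψ : AddChar K ℂ) (f : (Fin d → K) → ℝ) (m : Fin d → K) : ℂ :=
  ∑ x, f x * ψ (∑ i, m i * x i)

theorem conj_finiteFourier (ψ : AddChar K ℂ) (f : (Fin d → K) → ℝ) (m : Fin d → K) :
    (starRingEnd ℂ) (finiteFourier ψ f m) = ∑ x, f x * ψ (-∑ i, m i * x i) := by
  rw [finiteFourier, map_sum]
  refine sum_congr rfl fun x _ => ?_
  rw [map_mul, Complex.conj_ofReal, AddChar.map_neg_eq_conj]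

theorem sum_mul_conj_finiteFourier_mul {ψ : AddChar K ℂ} (hψ : ψ ≠ 1)
    (f g k : (Fin d → K) → ℝ) :
    ∑ m, finiteFourier ψ k m * (starRingEnd ℂ (finiteFourier ψ f m) * finiteFourier ψ g m) =
      (Fintype.card K : ℂ) ^ d * ((∑ x, ∑ y, f x * g y * k (x - y) : ℝ) : ℂ) := by
  simp_rw [conj_finiteFourier]
  have h : ∀ m : Fin d → K, finiteFourier ψ k m *
      ((∑ x, f x * ψ (-∑ i, m i * x i)) * finiteFourier ψ g m) =
      ∑ x, ∑ y, ∑ z, (f x * g y * k z : ℂ) * ψ (∑ i, m i * (z - (x - y)) i) := fun m => by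
    rw [finiteFourier, finiteFourier, sum_mul_sum, mul_comm, sum_mul]
    refine sum_congr rfl fun x _ => ?_
    rw [sum_mul]
    refine sum_congr rfl fun y _ => ?_
    rw [mul_sum]
    refine sum_congr rfl fun z _ => ?_
    have : ∑ i, m i * (z - (x - y)) i = ∑ i, m i * z i + (-∑ i, m i * x i + ∑ i, m i * y i) := by
      rw [← sum_neg_distrib, ← sum_add_distrib, ← sum_add_distrib]
      refine sum_congr rfl fun i _ => ?_
      simp only [Pi.sub_apply]
      ring
    rw [this, AddChar.map_add_eq_mul, AddChar.map_add_eq_mul]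
    ring
  simp_rw [h]
  rw [sum_comm, Complex.ofReal_sum, mul_sum]
  refine sum_congr rfl fun x _ => ?_
  rw [sum_comm, Complex.ofReal_sum, mul_sum]
  refine sum_congr rfl fun y _ => ?_
  rw [sum_comm]
  simp_rw [← mul_sum, sum_addChar_dotProduct hψ, sub_eq_zero]
  rw [sum_eq_single (x - y) (fun z _ hz => by rw [if_neg hz, mul_zero])
    (fun h => absurd (mem_univ _) h), if_pos rfl]
  push_cast
  ring

theorem sum_norm_finiteFourier_sq {ψ : AddChar K ℂ} (hψ : ψ ≠ 1) (f : (Fin d → K) → ℝ) :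
    ∑ m, ‖finiteFourier ψ f m‖ ^ 2 = (Fintype.card K : ℝ) ^ d * ∑ x, f x ^ 2 := by
  have h := sum_mul_conj_finiteFourier_mul hψ f f (fun z => if z = 0 then 1 else 0)
  have h1 : ∀ m : Fin d → K, finiteFourier ψ (fun z => if z = 0 then 1 else 0) m = 1 := fun m => by
    rw [finiteFourier, sum_eq_single 0 (fun z _ hz => by simp [hz])
      (fun h => absurd (mem_univ _) h)]
    simp
  simp_rw [h1, one_mul, Complex.conj_mul', sub_eq_zero] at h
  simp only [mul_ite, mul_one, mul_zero, sum_ite_eq, mem_univ, if_true, ← pow_two] at h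
  exact_mod_cast h

variable (K) in
theorem exists_addChar_ne_one : ∃ ψ : AddChar K ℂ, ψ ≠ 1 := by
  obtain ⟨ψ, h⟩ := AddChar.exists_apply_ne_zero.2 (one_ne_zero (α := K))
  exact ⟨ψ, fun h' => h (by rw [h', AddChar.one_apply])⟩

/-- The `ℓ²` operator bound for the sphere averaging operator. -/
theorem abs_sum_mul_sphereKernel_le (hK : ringChar K ≠ 2) {c : K} (hc : c ≠ 0)
    (f g : (Fin d → K) → ℝ) :
    |∑ x, ∑ y, f x * g y * sphereKernel c (x - y)| ≤
      2 * √(Fintype.card K) ^ (d + 1) * (√(∑ x, f x ^ 2) * √(∑ x, g x ^ 2)) := by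
  obtain ⟨ψ, hψ⟩ := exists_addChar_ne_one K
  have hQ : (0 : ℝ) < (Fintype.card K : ℝ) ^ d :=
    pow_pos (Nat.cast_pos.2 Fintype.card_pos) d
  set Q := (Fintype.card K : ℝ) ^ d with hQdef
  set B := 2 * √(Fintype.card K : ℝ) ^ (d + 1) with hB
  have h1 := congrArg norm (sum_mul_conj_finiteFourier_mul hψ f g (sphereKernel c))
  have h2 : ‖(Fintype.card K : ℂ) ^ d * ((∑ x, ∑ y, f x * g y * sphereKernel c (x - y) : ℝ) : ℂ)‖ =
      Q * |∑ x, ∑ y, f x * g y * sphereKernel c (x - y)| := by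
    rw [norm_mul, norm_pow, Complex.norm_natCast, ← Real.norm_eq_abs, ← Complex.norm_real]
  rw [h2] at h1
  have h3 : Q * |∑ x, ∑ y, f x * g y * sphereKernel c (x - y)| ≤
      B * (√(Q * ∑ x, f x ^ 2) * √(Q * ∑ x, g x ^ 2)) := by
    rw [← h1, ← sum_norm_finiteFourier_sq hψ f, ← sum_norm_finiteFourier_sq hψ g]
    refine (norm_sum_le _ _).trans ?_
    calc _ ≤ ∑ m, B * (‖finiteFourier ψ f m‖ * ‖finiteFourier ψ g m‖) := by
          refine sum_le_sum fun m _ => ?_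
          rw [norm_mul, norm_mul, RCLike.norm_conj]
          exact mul_le_mul_of_nonneg_right (norm_sum_sphereKernel_mul_le hK hψ hc m) (by positivity)
      _ ≤ _ := by
          rw [← mul_sum]
          exact mul_le_mul_of_nonneg_left (Real.sum_mul_le_sqrt_mul_sqrt _ _ _) (by positivity)
  rw [Real.sqrt_mul hQ.le, Real.sqrt_mul hQ.le] at h3
  refine le_of_mul_le_mul_left (h3.trans_eq ?_) hQ
  linear_combination (B * √(∑ x, f x ^ 2) * √(∑ x, g x ^ 2)) * Real.mul_self_sqrt hQ.le

end SphereOperator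

section GraphCount

variable {V X : Type*}

theorem Sym2.map_update_of_notMem {a : V} {e : Sym2 V} (h : a ∉ e) (x : V → X) (y : X) :
    e.map (Function.update x a y) = e.map x :=
  Sym2.map_congr fun _ hv => Function.update_of_ne (ne_of_mem_of_not_mem hv h) _ _

/-- The product of the edge weights `w` over the edge set `F` at the vertex placement `x`. -/
noncomputable def edgeProd (w : Sym2 V → Sym2 X → ℝ) (F : Finset (Sym2 V)) (x : V → X) : ℝ :=
  ∏ e ∈ F, w e (e.map x)

variable {w : Sym2 V → Sym2 X → ℝ} {Q B : ℝ}

theorem edgeProd_update (F : Finset (Sym2 V)) {a : V} (h : ∀ e ∈ F, a ∉ e) (x : V → X) (y : X) :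
    edgeProd w F (Function.update x a y) = edgeProd w F x :=
  prod_congr rfl fun e he => by rw [Sym2.map_update_of_notMem (h e he)]

theorem edgeProd_filter_mul (F : Finset (Sym2 V)) (a : V) (x : V → X) :
    edgeProd w (F.filter (a ∉ ·)) x * edgeProd w (F.filter (a ∈ ·)) x = edgeProd w F x := by
  rw [mul_comm]
  exact prod_filter_mul_prod_filter_not _ _ _

theorem edgeProd_sq (hw : ∀ e p, w e p ^ 2 = Q * w e p) (F : Finset (Sym2 V)) (x : V → X) :
    edgeProd w F x ^ 2 = Q ^ F.card * edgeProd w F x := by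
  rw [edgeProd, ← prod_pow]
  simp_rw [hw]
  rw [prod_mul_distrib, prod_const]

theorem edgeWeight_nonneg (hQ : 0 < Q) (hw : ∀ e p, w e p ^ 2 = Q * w e p) (e : Sym2 V)
    (p : Sym2 X) : 0 ≤ w e p :=
  nonneg_of_mul_nonneg_right (hw e p ▸ sq_nonneg _) hQ

theorem edgeProd_nonneg (hQ : 0 < Q) (hw : ∀ e p, w e p ^ 2 = Q * w e p) (F : Finset (Sym2 V))
    (x : V → X) : 0 ≤ edgeProd w F x :=
  prod_nonneg fun _ _ => edgeWeight_nonneg hQ hw _ _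

theorem edgeProd_le (hQ : 0 < Q) (hw : ∀ e p, w e p ^ 2 = Q * w e p) (F : Finset (Sym2 V))
    (x : V → X) : edgeProd w F x ≤ Q ^ F.card := by
  have h0 := edgeProd_nonneg hQ hw F x
  have h := edgeProd_sq hw F x
  have : (0 : ℝ) < Q ^ F.card := by positivity
  nlinarith

variable [Fintype V] [Fintype X]

theorem sum_sum_update (a : V) (φ : (V → X) → X → ℝ) :
    ∑ x, ∑ y, φ (Function.update x a y) (x a) = ∑ x, ∑ y, φ x y := by
  rw [← Fintype.sum_prod_type', ← Fintype.sum_prod_type' (f := φ)]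
  have h : Function.Involutive
      fun p : (V → X) × X => (Function.update p.1 a p.2, p.1 a) := fun p => by simp
  exact (Equiv.sum_comp h.toPerm fun p : (V → X) × X => φ p.1 p.2)

theorem sum_sum_update_eq_card_mul (a : V) (φ : (V → X) → ℝ) :
    ∑ x, ∑ y, φ (Function.update x a y) = Fintype.card X * ∑ x, φ x := by
  rw [sum_sum_update a fun x _ => φ x]
  simp [mul_sum]

/-- The weighted number of homomorphic copies of the edge set `F`. -/
noncomputable def weightedCount (w : Sym2 V → Sym2 X → ℝ) (F : Finset (Sym2 V)) : ℝ :=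
  ∑ x : V → X, edgeProd w F x

theorem card_mul_abs_weightedCount_insert_sub_le (hX : 0 < Fintype.card X) (hQ : 0 < Q)
    (hB : 0 ≤ B)
    (hw : ∀ e p, w e p ^ 2 = Q * w e p) {a b : V} (hab : a ≠ b) {F : Finset (Sym2 V)}
    (hF : s(a, b) ∉ F)
    (hop : ∀ f g : X → ℝ, |∑ y, ∑ z, f y * g z * (w s(a, b) s(y, z) - 1)| ≤
      B * (√(∑ y, f y ^ 2) * √(∑ z, g z ^ 2))) :
    Fintype.card X * |weightedCount w (insert s(a, b) F) - weightedCount w F| ≤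
      B * √Q ^ ((F.filter (a ∈ ·)).card + (F.filter (b ∈ ·)).card) *
        (√(weightedCount w (F.filter (b ∉ ·))) * √(weightedCount w (F.filter (a ∉ ·)))) := by
  set Fa := F.filter (a ∈ ·) with hFa
  set Fb := F.filter (b ∈ ·) with hFb
  set R := (F.filter (b ∉ ·)).filter (a ∉ ·) with hR
  have hR' : R = (F.filter (a ∉ ·)).filter (b ∉ ·) := by rw [hR, filter_comm]
  have hne : ∀ e ∈ F, a ∈ e → b ∉ e := fun e he ha hb =>
    hF (((Sym2.mem_and_mem_iff hab).1 ⟨ha, hb⟩) ▸ he)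
  have hFa' : (F.filter (b ∉ ·)).filter (a ∈ ·) = Fa := by
    ext e
    simp only [hFa, mem_filter]
    exact ⟨fun h => ⟨h.1.1, h.2⟩, fun h => ⟨⟨h.1, hne e h.1 h.2⟩, h.2⟩⟩
  have hFb' : (F.filter (a ∉ ·)).filter (b ∈ ·) = Fb := by
    ext e
    simp only [hFb, mem_filter]
    exact ⟨fun h => ⟨h.1.1, h.2⟩, fun h => ⟨⟨h.1, fun ha => hne e h.1 ha h.2⟩, h.2⟩⟩
  have hRa : ∀ e ∈ R, a ∉ e := fun e he => (mem_filter.1 he).2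
  have hRb : ∀ e ∈ R, b ∉ e := fun e he => (mem_filter.1 (mem_filter.1 he).1).2
  have hFab : ∀ e ∈ Fa, b ∉ e := fun e he => hne e (mem_filter.1 he).1 (mem_filter.1 he).2
  have hA : ∀ x y, edgeProd w (F.filter (b ∉ ·)) (Function.update x a y) =
      edgeProd w R x * edgeProd w Fa (Function.update x a y) := fun x y => by
    rw [← edgeProd_filter_mul (F.filter (b ∉ ·)) a, hFa', ← hR, edgeProd_update R hRa]
  have hBb : ∀ x y, edgeProd w (F.filter (a ∉ ·)) (Function.update x b y) =
      edgeProd w R x * edgeProd w Fb (Function.update x b y) := fun x y => by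
    rw [← edgeProd_filter_mul (F.filter (a ∉ ·)) b, hFb', ← hR', edgeProd_update R hRb]
  have hprod : ∀ x y z, edgeProd w F (Function.update (Function.update x a y) b z) =
      edgeProd w R x * edgeProd w Fa (Function.update x a y) *
        edgeProd w Fb (Function.update x b z) := fun x y z => by
    rw [← edgeProd_filter_mul F a, ← hFa, edgeProd_update Fa hFab, hBb, edgeProd_update R hRa,
      Function.update_comm hab, edgeProd_update Fb _]
    · ring
    · intro e he ha
      exact hne e (mem_filter.1 he).1 ha (mem_filter.1 he).2
  set M : ℝ := (Fintype.card X : ℝ) with hM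
  have hMpos : 0 < M := Nat.cast_pos.2 hX
  have hdiff : weightedCount w (insert s(a, b) F) - weightedCount w F =
      ∑ x : V → X, edgeProd w F x * (w s(a, b) s(x a, x b) - 1) := by
    rw [weightedCount, weightedCount, ← sum_sub_distrib]
    refine sum_congr rfl fun x _ => ?_
    rw [edgeProd, prod_insert hF, Sym2.map_mk, ← edgeProd]
    ring
  have hexp : M * (M * (weightedCount w (insert s(a, b) F) - weightedCount w F)) =
      ∑ x : V → X, edgeProd w R x * ∑ y, ∑ z, edgeProd w Fa (Function.update x a y) *
        edgeProd w Fb (Function.update x b z) * (w s(a, b) s(y, z) - 1) := by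
    rw [hdiff, ← sum_sum_update_eq_card_mul b, ← sum_sum_update_eq_card_mul a]
    refine sum_congr rfl fun x _ => ?_
    rw [mul_sum]
    refine sum_congr rfl fun y _ => ?_
    rw [mul_sum]
    refine sum_congr rfl fun z _ => ?_
    rw [hprod, Function.update_self, Function.update_of_ne hab, Function.update_self]
    ring
  have hsq : ∀ (G : Finset (Sym2 V)) (v : V) (x : V → X),
      √(∑ y, edgeProd w G (Function.update x v y) ^ 2) =
        √Q ^ G.card * √(∑ y, edgeProd w G (Function.update x v y)) := fun G v x => by
    simp_rw [edgeProd_sq hw]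
    rw [← mul_sum, Real.sqrt_mul (by positivity),
      ← Real.sqrt_sq (pow_nonneg (Real.sqrt_nonneg Q) G.card), ← pow_mul, mul_comm G.card, pow_mul,
      Real.sq_sqrt hQ.le]
  have hcA : ∑ x : V → X, edgeProd w R x * ∑ y, edgeProd w Fa (Function.update x a y) =
      M * weightedCount w (F.filter (b ∉ ·)) := by
    rw [weightedCount, ← sum_sum_update_eq_card_mul a]
    simp_rw [hA, mul_sum]
  have hcB : ∑ x : V → X, edgeProd w R x * ∑ y, edgeProd w Fb (Function.update x b y) =
      M * weightedCount w (F.filter (a ∉ ·)) := by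
    rw [weightedCount, ← sum_sum_update_eq_card_mul b]
    simp_rw [hBb, mul_sum]
  have hfin : M * (M * |weightedCount w (insert s(a, b) F) - weightedCount w F|) ≤
      B * √Q ^ (Fa.card + Fb.card) * (√(M * weightedCount w (F.filter (b ∉ ·))) *
        √(M * weightedCount w (F.filter (a ∉ ·)))) := by
    rw [← abs_of_pos hMpos, ← abs_mul, ← abs_mul, abs_of_pos hMpos, hexp, ← hcA, ← hcB]
    refine (abs_sum_le_sum_abs _ _).trans ?_
    calc _ ≤ ∑ x : V → X, B * √Q ^ (Fa.card + Fb.card) *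
          (√(edgeProd w R x * ∑ y, edgeProd w Fa (Function.update x a y)) *
            √(edgeProd w R x * ∑ y, edgeProd w Fb (Function.update x b y))) := by
          refine sum_le_sum fun x _ => ?_
          have h0 := edgeProd_nonneg hQ hw R x
          rw [abs_mul, abs_of_nonneg h0]
          refine (mul_le_mul_of_nonneg_left (hop _ _) h0).trans_eq ?_
          rw [hsq, hsq, Real.sqrt_mul h0, Real.sqrt_mul h0, pow_add]
          nth_rewrite 1 [← Real.mul_self_sqrt h0]
          ring
      _ ≤ _ := by
          rw [← mul_sum]
          refine mul_le_mul_of_nonneg_left ?_ (by positivity)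
          refine Real.sum_sqrt_mul_sqrt_le _ (fun x => ?_) fun x => ?_
          · exact mul_nonneg (edgeProd_nonneg hQ hw _ _)
              (sum_nonneg fun _ _ => edgeProd_nonneg hQ hw _ _)
          · exact mul_nonneg (edgeProd_nonneg hQ hw _ _)
              (sum_nonneg fun _ _ => edgeProd_nonneg hQ hw _ _)
  rw [Real.sqrt_mul hMpos.le, Real.sqrt_mul hMpos.le] at hfin
  refine le_of_mul_le_mul_left (hfin.trans_eq ?_) hMpos
  linear_combination (B * √Q ^ (Fa.card + Fb.card) * (√(weightedCount w (F.filter (b ∉ ·))) *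
    √(weightedCount w (F.filter (a ∉ ·))))) * Real.mul_self_sqrt hMpos.le

theorem abs_weightedCount_sub_le (hX : 0 < Fintype.card X) (hQ : 1 ≤ Q) (hB : 0 ≤ B)
    (hw : ∀ e p, w e p ^ 2 = Q * w e p) {n : ℕ} {δ : ℝ} (hδ : 0 ≤ δ) (hnδ : n * δ ≤ 1)
    (hBδ : 2 * B * √Q ^ (n - 1) ≤ δ * Fintype.card X)
    (F : Finset (Sym2 V)) (hFn : F.card ≤ n) (hF : ∀ e ∈ F, ¬ e.IsDiag)
    (hop : ∀ a b, s(a, b) ∈ F → ∀ f g : X → ℝ,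
      |∑ y, ∑ z, f y * g z * (w s(a, b) s(y, z) - 1)| ≤
        B * (√(∑ y, f y ^ 2) * √(∑ z, g z ^ 2))) :
    |weightedCount w F - (Fintype.card X : ℝ) ^ Fintype.card V| ≤
      F.card * δ * (Fintype.card X : ℝ) ^ Fintype.card V := by
  have hQ0 : 0 < Q := one_pos.trans_le hQ
  set M : ℝ := (Fintype.card X : ℝ) with hM
  have hMpos : 0 < M := Nat.cast_pos.2 hX
  induction F using Finset.strongInduction with
  | H F ih =>
  have hupper : ∀ G ⊂ F, weightedCount w G ≤ 2 * M ^ Fintype.card V := fun G hG => by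
    have h1 := ih G hG ((card_le_card hG.1).trans hFn) (fun e he => hF e (hG.1 he))
      (fun a b h => hop a b (hG.1 h))
    have h2 : (G.card : ℝ) * δ ≤ 1 := le_trans (mul_le_mul_of_nonneg_right
      (Nat.cast_le.2 ((card_le_card hG.1).trans hFn)) hδ) hnδ
    have h3 : (G.card : ℝ) * δ * M ^ Fintype.card V ≤ 1 * M ^ Fintype.card V :=
      mul_le_mul_of_nonneg_right h2 (by positivity)
    linarith [(abs_le.1 h1).2]
  obtain rfl | ⟨e, he⟩ := F.eq_empty_or_nonempty
  · simp [weightedCount, edgeProd, hM]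
  induction e using Sym2.ind with
  | _ a b =>
  have hab : a ≠ b := fun h => hF _ he (Sym2.mk_isDiag_iff.2 h)
  set F₀ := F.erase s(a, b) with hF₀
  have hnot : s(a, b) ∉ F₀ := notMem_erase _ _
  have hss : F₀ ⊂ F := erase_ssubset he
  have hins : insert s(a, b) F₀ = F := insert_erase he
  have hcard : F₀.card + 1 = F.card := card_erase_add_one he
  have hstep := card_mul_abs_weightedCount_insert_sub_le hX hQ0 hB hw hab hnot (hop a b he)
  rw [hins] at hstep
  have hdeg : (F₀.filter (a ∈ ·)).card + (F₀.filter (b ∈ ·)).card ≤ n - 1 := by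
    rw [← card_union_of_disjoint]
    · refine (card_le_card (union_subset (filter_subset _ _) (filter_subset _ _))).trans ?_
      omega
    · refine disjoint_filter.2 fun e he ha hb => hnot ?_
      exact ((Sym2.mem_and_mem_iff hab).1 ⟨ha, hb⟩) ▸ he
  have hpow : √Q ^ ((F₀.filter (a ∈ ·)).card + (F₀.filter (b ∈ ·)).card) ≤ √Q ^ (n - 1) :=
    pow_le_pow_right₀ (Real.one_le_sqrt.2 hQ) hdeg
  have hs : √(weightedCount w (F₀.filter (b ∉ ·))) * √(weightedCount w (F₀.filter (a ∉ ·))) ≤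
      2 * M ^ Fintype.card V := by
    rw [← Real.mul_self_sqrt (show 0 ≤ 2 * M ^ Fintype.card V by positivity)]
    gcongr
    · exact hupper _ ((filter_subset _ _).trans_ssubset hss)
    · exact hupper _ ((filter_subset _ _).trans_ssubset hss)
  have hstep' : |weightedCount w F - weightedCount w F₀| ≤ δ * M ^ Fintype.card V := by
    refine le_of_mul_le_mul_left (hstep.trans ?_) hMpos
    calc _ ≤ B * √Q ^ (n - 1) * (2 * M ^ Fintype.card V) := by gcongr
      _ = 2 * B * √Q ^ (n - 1) * M ^ Fintype.card V := by ring
      _ ≤ δ * M * M ^ Fintype.card V := by gcongr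
      _ = _ := by ring
  have h1 := ih F₀ hss (by omega) (fun e he => hF e (hss.1 he)) (fun a b h => hop a b (hss.1 h))
  have h2 : (F.card : ℝ) = F₀.card + 1 := by exact_mod_cast hcard.symm
  calc _ ≤ |weightedCount w F - weightedCount w F₀| +
        |weightedCount w F₀ - M ^ Fintype.card V| := abs_sub_le _ _ _
    _ ≤ δ * M ^ Fintype.card V + F₀.card * δ * M ^ Fintype.card V := add_le_add hstep' h1
    _ = _ := by rw [h2]; ring

theorem sum_edgeProd_coincidence_le (hQ : 1 ≤ Q)
    (hw : ∀ e p, w e p ^ 2 = Q * w e p) (F : Finset (Sym2 V)) {a b : V} (hab : a ≠ b) :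
    Fintype.card X * ∑ x : V → X with x a = x b, edgeProd w F x ≤
      Q ^ F.card * weightedCount w (F.filter (a ∉ ·)) := by
  have hQ0 : 0 < Q := one_pos.trans_le hQ
  have h1 : ∀ x : V → X, edgeProd w F x ≤ Q ^ F.card * edgeProd w (F.filter (a ∉ ·)) x :=
    fun x => by
      rw [← edgeProd_filter_mul F a, mul_comm]
      refine mul_le_mul_of_nonneg_right ((edgeProd_le hQ0 hw _ _).trans ?_)
        (edgeProd_nonneg hQ0 hw _ _)
      exact pow_le_pow_right₀ hQ (card_le_card (filter_subset _ _))
  have h2 : (Fintype.card X : ℝ) * ∑ x : V → X with x a = x b, edgeProd w (F.filter (a ∉ ·)) x =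
      weightedCount w (F.filter (a ∉ ·)) := by
    rw [sum_filter, ← sum_sum_update_eq_card_mul a]
    refine sum_congr rfl fun x _ => ?_
    simp_rw [Function.update_self, Function.update_of_ne hab.symm]
    rw [sum_ite_eq' univ (x b), if_pos (mem_univ _)]
    exact edgeProd_update _ (fun e he => (mem_filter.1 he).2) _ _
  rw [← h2, mul_left_comm]
  refine mul_le_mul_of_nonneg_left ?_ (Nat.cast_nonneg _)
  rw [mul_sum]
  exact sum_le_sum fun x _ => h1 x

theorem abs_sum_injective_edgeProd_sub_le (hX : 0 < Fintype.card X) (hQ : 1 ≤ Q) (hB : 0 ≤ B)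
    (hw : ∀ e p, w e p ^ 2 = Q * w e p) {n : ℕ} {δ : ℝ} (hδ : 0 ≤ δ) (hnδ : n * δ ≤ 1)
    (hBδ : 2 * B * √Q ^ (n - 1) ≤ δ * Fintype.card X) (hQδ : Q ^ n ≤ δ * Fintype.card X)
    (F : Finset (Sym2 V)) (hFn : F.card = n) (hF : ∀ e ∈ F, ¬ e.IsDiag)
    (hop : ∀ a b, s(a, b) ∈ F → ∀ f g : X → ℝ,
      |∑ y, ∑ z, f y * g z * (w s(a, b) s(y, z) - 1)| ≤
        B * (√(∑ y, f y ^ 2) * √(∑ z, g z ^ 2))) :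
    |∑ x : V → X with Function.Injective x, edgeProd w F x -
        (Fintype.card X : ℝ) ^ Fintype.card V| ≤
      (n + 2 * (Fintype.card V : ℝ) ^ 2) * δ * (Fintype.card X : ℝ) ^ Fintype.card V := by
  have hQ0 : 0 < Q := one_pos.trans_le hQ
  set M : ℝ := (Fintype.card X : ℝ) with hM
  have hMpos : 0 < M := Nat.cast_pos.2 hX
  have hall := abs_weightedCount_sub_le hX hQ hB hw hδ hnδ hBδ F hFn.le hF hop
  rw [hFn] at hall
  have hpair : ∀ p ∈ (univ : Finset V).offDiag,
      ∑ x : V → X with x p.1 = x p.2, edgeProd w F x ≤ 2 * δ * M ^ Fintype.card V := fun p hp => by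
    have h1 := sum_edgeProd_coincidence_le hQ hw F (mem_offDiag.1 hp).2.2
    have hsub : F.filter (p.1 ∉ ·) ⊆ F := filter_subset _ _
    have h2 := abs_weightedCount_sub_le hX hQ hB hw hδ hnδ hBδ (F.filter (p.1 ∉ ·))
      ((card_le_card hsub).trans hFn.le) (fun e he => hF e (hsub he))
      (fun a b h => hop a b (hsub h))
    have h3 : ((F.filter (p.1 ∉ ·)).card : ℝ) * δ ≤ 1 := le_trans (mul_le_mul_of_nonneg_right
      (Nat.cast_le.2 ((card_le_card hsub).trans hFn.le)) hδ) hnδ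
    have h4 : ((F.filter (p.1 ∉ ·)).card : ℝ) * δ * M ^ Fintype.card V ≤ 1 * M ^ Fintype.card V :=
      mul_le_mul_of_nonneg_right h3 (by positivity)
    have h5 : weightedCount w (F.filter (p.1 ∉ ·)) ≤ 2 * M ^ Fintype.card V := by
      linarith [(abs_le.1 h2).2]
    refine le_of_mul_le_mul_left (h1.trans ?_) hMpos
    rw [hFn]
    calc _ ≤ (δ * M) * (2 * M ^ Fintype.card V) :=
          mul_le_mul hQδ h5 (sum_nonneg fun _ _ => edgeProd_nonneg hQ0 hw _ _) (by positivity)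
      _ = _ := by ring
  have hbad : ∑ x : V → X with ¬ Function.Injective x, edgeProd w F x ≤
      2 * (Fintype.card V : ℝ) ^ 2 * δ * M ^ Fintype.card V := by
    calc _ ≤ ∑ p ∈ (univ : Finset V).offDiag, ∑ x : V → X with x p.1 = x p.2, edgeProd w F x := by
          simp_rw [sum_filter]
          rw [sum_comm]
          refine sum_le_sum fun x _ => ?_
          have h0 : ∀ p ∈ (univ : Finset V).offDiag,
              0 ≤ if x p.1 = x p.2 then edgeProd w F x else 0 := fun p _ => by
            split_ifs
            exacts [edgeProd_nonneg hQ0 hw F x, le_rfl]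
          split_ifs with hx
          · exact sum_nonneg h0
          · simp only [Function.Injective] at hx
            push Not at hx
            obtain ⟨a, b, h, hne⟩ := hx
            have hab := single_le_sum h0 (a := (a, b)) (mem_offDiag.2 ⟨mem_univ a, mem_univ b, hne⟩)
            rwa [if_pos h] at hab
      _ ≤ (univ : Finset V).offDiag.card • (2 * δ * M ^ Fintype.card V) :=
          sum_le_card_nsmul _ _ _ hpair
      _ ≤ (Fintype.card V : ℝ) ^ 2 * (2 * δ * M ^ Fintype.card V) := by
          rw [nsmul_eq_mul]
          refine mul_le_mul_of_nonneg_right ?_ (by positivity)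
          rw [offDiag_card, card_univ, pow_two]
          exact_mod_cast Nat.sub_le _ _
      _ = _ := by ring
  have hbad0 : 0 ≤ ∑ x : V → X with ¬ Function.Injective x, edgeProd w F x :=
    sum_nonneg fun _ _ => edgeProd_nonneg hQ0 hw _ _
  have hsplit : ∑ x : V → X with Function.Injective x, edgeProd w F x +
      ∑ x : V → X with ¬ Function.Injective x, edgeProd w F x = weightedCount w F :=
    sum_filter_add_sum_filter_not _ _ _
  have hsq : 0 ≤ 2 * (Fintype.card V : ℝ) ^ 2 * δ * M ^ Fintype.card V := by positivity
  rw [abs_le] at hall ⊢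
  constructor <;> nlinarith [hall.1, hall.2]

end GraphCount

section DistanceGraph

variable {K : Type*} [Field K] [Fintype K] {d : ℕ}

/-- The density-normalised indicator that a pair of points has distance `c`. -/
noncomputable def distWeight (c : K) : Sym2 (Fin d → K) → ℝ :=
  Sym2.lift ⟨fun x y => if ∑ l, (x l - y l) ^ 2 = c then (Fintype.card K : ℝ) else 0,
    fun x y => by simp_rw [sub_sq_comm (x _)]⟩

theorem distWeight_mk (c : K) (x y : Fin d → K) : distWeight c s(x, y) =
    if ∑ l, (x l - y l) ^ 2 = c then (Fintype.card K : ℝ) else 0 := rfl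

theorem distWeight_sq (c : K) (p : Sym2 (Fin d → K)) :
    distWeight c p ^ 2 = Fintype.card K * distWeight c p := by
  induction p using Sym2.ind with
  | _ x y =>
    rw [distWeight_mk]
    split_ifs <;> ring

theorem sum_extend_mul {X : Type*} [Fintype X] (E : Finset X) (f : E → ℝ) (φ : X → ℝ) :
    ∑ z, Function.extend Subtype.val f 0 z * φ z = ∑ y : E, f y * φ y := by
  rw [← sum_subset (subset_univ E), ← sum_coe_sort]
  · exact sum_congr rfl fun y _ => by rw [Subtype.val_injective.extend_apply]
  · intro z _ hz
    rw [Function.extend_apply' _ _ _ (by rintro ⟨y, rfl⟩; exact hz y.2), Pi.zero_apply, zero_mul]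

theorem abs_sum_mul_distWeight_sub_one_le (hK : ringChar K ≠ 2) {c : K} (hc : c ≠ 0)
    (E : Finset (Fin d → K)) (f g : E → ℝ) :
    |∑ y, ∑ z, f y * g z * (distWeight c (s(y, z).map Subtype.val) - 1)| ≤
      2 * √(Fintype.card K) ^ (d + 1) * (√(∑ y, f y ^ 2) * √(∑ z, g z ^ 2)) := by
  have h := abs_sum_mul_sphereKernel_le hK hc (Function.extend Subtype.val f 0)
    (Function.extend Subtype.val g 0)
  have hsq : ∀ f : E → ℝ, ∑ z, Function.extend Subtype.val f 0 z ^ 2 = ∑ y, f y ^ 2 := fun f => by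
    simp_rw [pow_two]
    rw [sum_extend_mul]
    exact sum_congr rfl fun y _ => by rw [Subtype.val_injective.extend_apply]
  rw [hsq, hsq] at h
  refine le_of_eq_of_le (congrArg abs ?_) h
  simp_rw [mul_assoc, ← mul_sum, sum_extend_mul]
  rfl

theorem sum_injective_edgeProd_eq {k : ℕ} (H : SimpleGraph (Fin k)) (c : Sym2 (Fin k) → K)
    (E : Finset (Fin d → K)) :
    ∑ x : Fin k → E with Function.Injective x,
        edgeProd (fun e p => distWeight (c e) (p.map Subtype.val)) H.edgeFinset x =
      (Fintype.card K : ℝ) ^ H.edgeFinset.card *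
        ((univ.filter (fun x : Fin k → (Fin d → K) =>
          Function.Injective x ∧ (∀ i, x i ∈ E) ∧
          ∀ i j, H.Adj i j → ∑ l, (x i l - x j l) ^ 2 = c s(i, j))).card : ℝ) := by
  have hprod : ∀ x : Fin k → E,
      edgeProd (fun e p => distWeight (c e) (p.map Subtype.val)) H.edgeFinset x =
      if ∀ i j, H.Adj i j → ∑ l, ((x i : Fin d → K) l - (x j : Fin d → K) l) ^ 2 = c s(i, j) then
        (Fintype.card K : ℝ) ^ H.edgeFinset.card else 0 := fun x => by
    rw [edgeProd]
    split_ifs with h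
    · refine prod_eq_pow_card fun e he => ?_
      induction e using Sym2.ind with
      | _ i j => exact if_pos (h i j (SimpleGraph.mem_edgeFinset.1 he))
    · push Not at h
      obtain ⟨i, j, hij, hne⟩ := h
      exact prod_eq_zero (SimpleGraph.mem_edgeFinset.2 hij : s(i, j) ∈ _) (if_neg hne)
  simp_rw [hprod]
  rw [← sum_filter, sum_const, nsmul_eq_mul, mul_comm, filter_filter]
  congr 2
  refine card_nbij (fun x i => (x i : Fin d → K)) (fun x hx => ?_) (fun x _ y _ hxy => ?_)
    fun x hx => ?_
  · simp only [mem_coe, mem_filter, mem_univ, true_and] at hx ⊢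
    exact ⟨Subtype.val_injective.comp hx.1, fun i => (x i).2, hx.2⟩
  · exact funext fun i => Subtype.ext (congrFun hxy i)
  · simp only [mem_coe, mem_filter, mem_univ, true_and] at hx
    refine ⟨fun i => ⟨x i, hx.2.1 i⟩, ?_, rfl⟩
    simp only [mem_coe, mem_filter, mem_univ, true_and]
    exact ⟨fun i j hij => hx.1 (congrArg Subtype.val hij), hx.2.2⟩

end DistanceGraph

theorem rpow_mul_rpow_ge_sqrt_pow {q : ℝ} (hq : 1 ≤ q) {d k n : ℕ} (hk : 2 ≤ k) (hnd : n ≤ d) :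
    √q ^ (d + n) ≤ q ^ ((d : ℝ) * ((k : ℝ) - 1) / k) * q ^ ((n : ℝ) / k) := by
  have hq0 : 0 < q := one_pos.trans_le hq
  rw [← Real.rpow_add hq0, Real.sqrt_eq_rpow, ← Real.rpow_natCast, ← Real.rpow_mul hq0.le]
  refine Real.rpow_le_rpow_of_exponent_le hq ?_
  have hk' : (2 : ℝ) ≤ k := by exact_mod_cast hk
  have hnd' : (n : ℝ) ≤ d := by exact_mod_cast hnd
  rw [← add_div, le_div_iff₀ (by linarith)]
  push_cast
  nlinarith

/-- Hart–Iosevich–Koh–Senger–Uriarte-Tuero: Let `d ≥ 2`,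
`1 ≤ k - 1 ≤ n ≤ d`, `ε > 0`. There is `C > 0` such that for every odd prime power `q`,
every graph `H` on `{1, …, k}` with `n` edges whose edges are colored by elements of
`𝔽_q^*`, and every `E ⊆ 𝔽_q^d` with `|E| ≥ C q^(d(k-1)/k) q^(n/k)`, the number `N` of
labelled copies of the colored graph `H` inside `E` (colors given by the Euclidean
distance `‖x - y‖ = ∑ (xᵢ - yᵢ)²`) satisfies `|N - |E|^k q^(-n)| ≤ ε |E|^k q^(-n)`. -/
theorem distance_graph_colored_subgraphs (d k n : ℕ) (hd : 2 ≤ d)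
    (hk : 2 ≤ k) (hkn : k - 1 ≤ n) (hnd : n ≤ d)
    (ε : ℝ) (hε : 0 < ε) :
    ∃ C : ℝ, 0 < C ∧
      ∀ (q : ℕ), IsPrimePow q → Odd q →
      ∀ (K : Type) [Field K] [Fintype K], Fintype.card K = q →
      ∀ (H : SimpleGraph (Fin k)), H.edgeFinset.card = n →
      ∀ (c : Sym2 (Fin k) → K), (∀ e ∈ H.edgeSet, c e ≠ 0) →
      ∀ (E : Finset (Fin d → K)),
      C * (q : ℝ) ^ ((d : ℝ) * ((k : ℝ) - 1) / k) * (q : ℝ) ^ ((n : ℝ) / k) ≤ E.card →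
      |((Finset.univ.filter (fun x : Fin k → (Fin d → K) =>
            Function.Injective x ∧ (∀ i, x i ∈ E) ∧
            ∀ i j, H.Adj i j → ∑ l, (x i l - x j l) ^ 2 = c s(i, j))).card : ℝ)
          - (E.card : ℝ) ^ k / (q : ℝ) ^ n|
        ≤ ε * ((E.card : ℝ) ^ k / (q : ℝ) ^ n) := by
  set D : ℝ := 4 * n + 8 * k ^ 2 with hD
  have hn1 : 1 ≤ n := by omega
  have hDpos : 0 < D := by positivity
  refine ⟨D * (1 + 1 / ε), by positivity, ?_⟩
  intro q _ hodd K _ _ hcard H hHn c hc E hE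
  have hK : ringChar K ≠ 2 := fun h => by
    have := FiniteField.even_card_iff_char_two.1 h
    rw [hcard] at this
    exact absurd (Nat.odd_iff.1 hodd) (by omega)
  have hq : (1 : ℝ) ≤ q := by exact_mod_cast hodd.pos
  have hq0 : (0 : ℝ) < q := one_pos.trans_le hq
  have hlow : D * (1 + 1 / ε) * √q ^ (d + n) ≤ E.card := by
    refine le_trans ?_ hE
    rw [mul_assoc (D * (1 + 1 / ε))]
    exact mul_le_mul_of_nonneg_left (rpow_mul_rpow_ge_sqrt_pow hq hk hnd) (by positivity)
  have hM : (0 : ℝ) < E.card := lt_of_lt_of_le (by positivity) hlow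
  set δ : ℝ := 4 / (D * (1 + 1 / ε)) with hδ
  have hδD : δ * (D * (1 + 1 / ε)) = 4 := div_mul_cancel₀ _ (by positivity)
  have hδ0 : 0 < δ := by positivity
  have hδM : 4 * √(q : ℝ) ^ (d + n) ≤ δ * E.card := by
    rw [← hδD, mul_assoc]
    exact mul_le_mul_of_nonneg_left hlow hδ0.le
  have hC : D ≤ D * (1 + 1 / ε) := le_mul_of_one_le_right hDpos.le (by simp [hε.le])
  have hnδ : n * δ ≤ 1 := by
    have h1 : δ * D ≤ 4 := hδD ▸ mul_le_mul_of_nonneg_left hC hδ0.le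
    have h2 : 0 ≤ δ * (8 * (k : ℝ) ^ 2) := by positivity
    rw [hD, mul_add] at h1
    linarith
  have hδε : (n + 2 * (k : ℝ) ^ 2) * δ ≤ ε := by
    have h1 : δ * D * (1 + ε) = 4 * ε := by
      rw [← hδD]
      field_simp
      ring
    have h2 : 0 ≤ δ * D * ε := by positivity
    have h3 : δ * D = 4 * ((n + 2 * (k : ℝ) ^ 2) * δ) := by rw [hD]; ring
    linarith
  have hBδ : 2 * (2 * √(q : ℝ) ^ (d + 1)) * √(q : ℝ) ^ (n - 1) ≤ δ * E.card := by
    refine le_of_eq_of_le ?_ hδM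
    rw [← mul_assoc, mul_assoc, ← pow_add, show d + 1 + (n - 1) = d + n by omega]
    norm_num
  have hQδ : (q : ℝ) ^ n ≤ δ * E.card := by
    refine le_trans ?_ hδM
    have h1 : (q : ℝ) ^ n = √(q : ℝ) ^ (n + n) := by
      rw [← two_mul, pow_mul, Real.sq_sqrt hq0.le]
    have h2 : √(q : ℝ) ^ (n + n) ≤ √(q : ℝ) ^ (d + n) :=
      pow_le_pow_right₀ (Real.one_le_sqrt.2 hq) (by omega)
    have h3 : 0 ≤ √(q : ℝ) ^ (d + n) := by positivity
    linarith
  have hmain := abs_sum_injective_edgeProd_sub_le (X := E)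
    (w := fun e p => distWeight (c e) (p.map Subtype.val)) (Q := q)
    (B := 2 * √(q : ℝ) ^ (d + 1)) (by rw [Fintype.card_coe]; exact_mod_cast hM) hq
    (by positivity) (fun e p => by rw [distWeight_sq, hcard]) hδ0.le hnδ
    (by rwa [Fintype.card_coe]) (by rwa [Fintype.card_coe]) H.edgeFinset hHn
    (fun e he => H.not_isDiag_of_mem_edgeFinset he)
    (fun a b hab f g => hcard ▸ abs_sum_mul_distWeight_sub_one_le hK
      (hc _ (SimpleGraph.mem_edgeFinset.1 hab)) E f g)
  rw [Fintype.card_coe, Fintype.card_fin] at hmain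
  have hcount := sum_injective_edgeProd_eq H c E
  rw [hHn, hcard] at hcount
  have hqn : (0 : ℝ) < (q : ℝ) ^ n := by positivity
  rw [← mul_div_assoc, le_div_iff₀ hqn, ← abs_of_pos hqn, ← abs_mul, abs_of_pos hqn, sub_mul,
    div_mul_cancel₀ _ hqn.ne', mul_comm _ ((q : ℝ) ^ n)]
  calc _ ≤ (n + 2 * (k : ℝ) ^ 2) * δ * (E.card : ℝ) ^ k := by
        rw [← hcount]
        refine le_of_eq_of_le (congrArg (fun t : ℝ => |t - (E.card : ℝ) ^ k|) ?_) hmain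
        congr!
    _ ≤ _ := mul_le_mul_of_nonneg_right hδε (by positivity)
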